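/- Let K ∈ ℝ, N ∈ [1,∞), let (X,d,m) be a CD*(K,N) metric measure space having the good transport property (GT), let phi be a c-concave function on X and let Omega ⊂ X be the interior of the set {phi > -∞}. Then for m-almost every x ∈ Omega there exists exactly one geodesic gamma ∈ Geo(X) such that gamma_0 = x and gamma_1 ∈ ∂^c phi(x). -/

import Mathlib

open MeasureTheory Metric Set unitInterval ENNReal NNReal

noncomputable section

variable {X : Type*} [MetricSpace X]

/-- A constant speed minimizing geodesic parametrized on `[0,1]`. -/
def IsUnitGeodesic (γ : C(unitInterval, X)) : Prop :=
  ∀ s t : unitInterval, dist (γ s) (γ t) = |(s : ℝ) - (t : ℝ)| * dist (γ 0) (γ 1)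

/-- The space of constant speed minimizing geodesics, with the sup distance. -/
def Geo (X : Type*) [MetricSpace X] : Type _ :=
  { γ : C(unitInterval, X) // IsUnitGeodesic γ }

instance : MetricSpace (Geo X) := Subtype.metricSpace
instance : MeasurableSpace (Geo X) := borel _
instance : BorelSpace (Geo X) := ⟨rfl⟩

/-- Evaluation map `e_t`. -/
def eval (t : unitInterval) (γ : Geo X) : X := γ.1 t

/-- `(X,d)` is a geodesic space: any two points are joined by a geodesic. -/
def IsGeodesicSpace (X : Type*) [MetricSpace X] : Prop :=
  ∀ x y : X, ∃ γ : Geo X, eval 0 γ = x ∧ eval 1 γ = y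

/-- The (topological) support of a measure. -/
def measSupport {Y : Type*} [TopologicalSpace Y] [MeasurableSpace Y] (μ : Measure Y) : Set Y :=
  {y | ∀ U ∈ nhds y, 0 < μ U}

variable [MeasurableSpace X]

/-- Finite second moment. -/
def HasFiniteSecondMoment (μ : Measure X) : Prop :=
  ∃ x₀ : X, ∫⁻ x, ENNReal.ofReal (dist x x₀ ^ 2) ∂μ ≠ ⊤

/-- The transport cost of a plan on the space of geodesics. -/
def transportCost (π : Measure (Geo X)) : ℝ≥0∞ :=
  ∫⁻ γ, ENNReal.ofReal (dist (eval 0 γ) (eval 1 γ) ^ 2) ∂π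

/-- `π ∈ OptGeo(μ,ν)`: an optimal geodesic plan from `μ` to `ν`. -/
def IsOptGeo (μ ν : Measure X) (π : Measure (Geo X)) : Prop :=
  IsProbabilityMeasure π ∧ π.map (eval 0) = μ ∧ π.map (eval 1) = ν ∧
    ∀ π' : Measure (Geo X), IsProbabilityMeasure π' →
      π'.map (eval 0) = μ → π'.map (eval 1) = ν →
      transportCost π ≤ transportCost π'

/-- The distortion coefficients `σ_{K,N}^{(t)}(θ)`. -/
def sigmaCoeff (K N t θ : ℝ) : ℝ≥0∞ :=
  if N * Real.pi ^ 2 ≤ K * θ ^ 2 then ⊤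
  else if 0 < K * θ ^ 2 then
    ENNReal.ofReal (Real.sin (t * θ * Real.sqrt (K / N)) / Real.sin (θ * Real.sqrt (K / N)))
  else if K * θ ^ 2 = 0 then ENNReal.ofReal t
  else ENNReal.ofReal (Real.sinh (t * θ * Real.sqrt (-K / N)) / Real.sinh (θ * Real.sqrt (-K / N)))

/-- The distortion coefficients `τ_{K,N}^{(t)}(θ)`. -/
def tauCoeff (K N t θ : ℝ) : ℝ≥0∞ :=
  if N = 1 then
    (if K ≤ 0 then ENNReal.ofReal t else if θ = 0 then ENNReal.ofReal t else ⊤)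
  else ENNReal.ofReal t ^ (1 / N) * sigmaCoeff K (N - 1) t θ ^ ((N - 1) / N)

/-- The (reduced) curvature dimension condition `CD*(K,N)`. -/
def IsCDStar (K N : ℝ) (m : Measure X) : Prop :=
  ∀ μ₀ μ₁ : Measure X, IsProbabilityMeasure μ₀ → IsProbabilityMeasure μ₁ →
    (∃ s : Set X, Bornology.IsBounded s ∧ μ₀ sᶜ = 0 ∧ μ₁ sᶜ = 0) →
    ∃ π : Measure (Geo X), IsOptGeo μ₀ μ₁ π ∧
      ∀ t : unitInterval, ∀ N' : ℝ, N ≤ N' →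
        ∫⁻ γ, (sigmaCoeff K N' (1 - (t : ℝ)) (dist (eval 0 γ) (eval 1 γ)) *
                 ((π.map (eval 0)).rnDeriv m (eval 0 γ)) ^ (-(1 / N')) +
               sigmaCoeff K N' (t : ℝ) (dist (eval 0 γ) (eval 1 γ)) *
                 ((π.map (eval 1)).rnDeriv m (eval 1 γ)) ^ (-(1 / N'))) ∂π
          ≤ ∫⁻ x, ((π.map (eval t)).rnDeriv m x) ^ (1 - 1 / N') ∂m

/-- The good transport property (GT): between absolutely continuous measures in `P₂(X)` there is
a unique optimal geodesic plan, and it is induced by a map from every intermediate time. -/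
def GoodTransport (m : Measure X) : Prop :=
  ∀ μ ν : Measure X, IsProbabilityMeasure μ → IsProbabilityMeasure ν →
    HasFiniteSecondMoment μ → HasFiniteSecondMoment ν → μ ≪ m → ν ≪ m →
    (∃! π : Measure (Geo X), IsOptGeo μ ν π) ∧
    ∀ π : Measure (Geo X), IsOptGeo μ ν π → ∀ t : unitInterval,
      ∃ T : X → Geo X, Measurable T ∧ π = (π.map (eval t)).map T

/-- `c`-concavity (with `c = d²/2`) for functions with values in `ℝ ∪ {-∞}`. -/
def cConcave (φ : X → EReal) : Prop :=
  (∃ x, φ x ≠ ⊥) ∧ (∀ x, φ x ≠ ⊤) ∧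
    ∃ ψ : X → EReal, (∀ y, ψ y ≠ ⊤) ∧
      ∀ x, φ x = ⨅ y, ((dist x y ^ 2 / 2 : ℝ) : EReal) - ψ y

/-- The `c`-transform `φᶜ`. -/
def cTransform (φ : X → EReal) : X → EReal :=
  fun y => ⨅ x, ((dist x y ^ 2 / 2 : ℝ) : EReal) - φ x

/-- The `c`-superdifferential `∂ᶜφ`. -/
def cSuperdiff (φ : X → EReal) : Set (X × X) :=
  {p | φ p.1 + cTransform φ p.2 = ((dist p.1 p.2 ^ 2 / 2 : ℝ) : EReal)}

/-- Kantorovich potential from `μ` to `ν`. -/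
def IsKantorovichPotential (μ ν : Measure X) (φ : X → EReal) : Prop :=
  cConcave φ ∧ ∀ π : Measure (Geo X), IsOptGeo μ ν π →
    measSupport (π.map (fun γ => (eval 0 γ, eval 1 γ))) ⊆ cSuperdiff φ


set_option linter.unusedSectionVars false
set_option linter.style.haveILetI false

lemma continuous_geval {X : Type*} [MetricSpace X] (t : unitInterval) :
    Continuous (eval t : Geo X → X) :=
  (continuous_eval_const t).comp continuous_subtype_val

lemma measurable_geval [BorelSpace X] (t : unitInterval) : Measurable (eval t : Geo X → X) :=
  (continuous_geval t).measurable

lemma geo_dist {X : Type*} [MetricSpace X] (γ : Geo X) (s t : unitInterval) :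
    dist (eval s γ) (eval t γ) = |(s : ℝ) - (t : ℝ)| * dist (eval 0 γ) (eval 1 γ) := γ.2 s t

def restrPt (a b u : unitInterval) : unitInterval :=
  ⟨(1 - (u : ℝ)) * a + u * b, by
    have := u.2.1; have := u.2.2; have := a.2.1; have := a.2.2; have := b.2.1; have := b.2.2
    constructor
    · exact add_nonneg (mul_nonneg (by linarith) a.2.1) (mul_nonneg u.2.1 b.2.1)
    · nlinarith⟩

lemma continuous_restrPt (a b : unitInterval) : Continuous (restrPt a b) := by
  unfold restrPt
  apply Continuous.subtype_mk
  fun_prop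

@[simp] lemma restrPt_zero (a b : unitInterval) : restrPt a b 0 = a := by
  apply Subtype.ext; simp [restrPt]

@[simp] lemma restrPt_one (a b : unitInterval) : restrPt a b 1 = b := by
  apply Subtype.ext; simp [restrPt]

def restrGeo {X : Type*} [MetricSpace X] (a b : unitInterval) (γ : Geo X) : Geo X :=
  ⟨γ.1.comp ⟨restrPt a b, continuous_restrPt a b⟩, by
    intro s t
    have h1 := γ.2 (restrPt a b s) (restrPt a b t)
    have h2 := γ.2 a b
    simp only [ContinuousMap.comp_apply, ContinuousMap.coe_mk, restrPt_zero, restrPt_one]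
    rw [h1, h2, ← mul_assoc, ← abs_mul]
    congr 1
    rw [← abs_neg]
    congr 1
    simp only [restrPt]
    ring⟩

lemma eval_restrGeo {X : Type*} [MetricSpace X] (a b u : unitInterval) (γ : Geo X) :
    eval u (restrGeo a b γ) = eval (restrPt a b u) γ := rfl

lemma continuous_restrGeo {X : Type*} [MetricSpace X] (a b : unitInterval) :
    Continuous (restrGeo a b : Geo X → Geo X) := by
  unfold restrGeo
  apply Continuous.subtype_mk
  exact (ContinuousMap.continuous_precomp _).comp continuous_subtype_val

lemma geo_closed_subtype {X : Type*} [MetricSpace X] :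
    IsClosed {γ : C(unitInterval, X) | IsUnitGeodesic γ} := by
  unfold IsUnitGeodesic
  simp only [ofPred_forall]
  refine isClosed_iInter fun s => isClosed_iInter fun t => isClosed_eq ?_ ?_ <;> fun_prop

def geoVal {X : Type*} [MetricSpace X] (γ : Geo X) : C(unitInterval, X) := γ.1

lemma geo_ext {X : Type*} [MetricSpace X] {γ γ' : Geo X} (h : ∀ t, eval t γ = eval t γ') :
    γ = γ' := Subtype.ext (ContinuousMap.ext h)

lemma geoVal_emb {X : Type*} [MetricSpace X] :
    Topology.IsClosedEmbedding (geoVal : Geo X → C(unitInterval, X)) :=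
  geo_closed_subtype.isClosedEmbedding_subtypeVal

/-- geodesics through a bounded set form a compact set -/
lemma geo_compact {X : Type*} [MetricSpace X] [ProperSpace X] (x₀ : X) (R : ℝ) (Z : Set (Geo X))
    (hZ : IsClosed Z) (hb : ∀ γ ∈ Z, dist (eval 0 γ) x₀ ≤ R ∧ dist (eval 1 γ) x₀ ≤ R) :
    IsCompact Z := by
  have hcl : IsClosed (geoVal '' Z) := geoVal_emb.isClosedMap Z hZ
  have hd : ∀ γ ∈ Z, dist (eval 0 γ) (eval 1 γ) ≤ 2 * R := by
    intro γ hγ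
    have := dist_triangle_right (eval 0 γ) (eval 1 γ) x₀
    linarith [(hb γ hγ).1, (hb γ hγ).2]
  have hc : IsCompact (geoVal '' Z) := by
    have key := BoundedContinuousFunction.arzela_ascoli₂ (α := unitInterval) (β := X)
      (closedBall x₀ (3 * R)) (isCompact_closedBall _ _)
      ((ContinuousMap.isometryEquivBoundedOfCompact unitInterval X) '' (geoVal '' Z))
      ((ContinuousMap.isometryEquivBoundedOfCompact unitInterval X).toHomeomorph.isClosedMap _ hcl)
      (by
        rintro _ t ⟨_, ⟨γ, hγ, rfl⟩, rfl⟩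
        have h1 : dist (eval t γ) (eval 0 γ) ≤ 2 * R := by
          rw [geo_dist]
          have h0 := t.2.1
          have h1 := t.2.2
          have : |(t : ℝ) - ((0 : unitInterval) : ℝ)| ≤ 1 := by
            simp only [Set.Icc.coe_zero, sub_zero]
            rw [abs_of_nonneg h0]; exact h1
          nlinarith [dist_nonneg (x := eval 0 γ) (y := eval 1 γ), hd γ hγ]
        have h2 := dist_triangle (eval t γ) (eval 0 γ) x₀
        have h3 := (hb γ hγ).1
        show dist (eval t γ) x₀ ≤ 3 * R
        linarith)
      (by
        refine Metric.equicontinuous_of_continuity_modulus (fun r => r * (2 * R)) ?_ _ ?_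
        · have : Filter.Tendsto (fun r : ℝ => r * (2 * R)) (nhds 0) (nhds (0 * (2 * R))) :=
            (continuous_id.mul continuous_const).tendsto _
          simpa using this
        · rintro s t ⟨_, ⟨_, ⟨γ, hγ, rfl⟩, rfl⟩⟩
          show dist (eval s γ) (eval t γ) ≤ dist s t * (2 * R)
          rw [geo_dist]
          exact mul_le_mul_of_nonneg_left (hd γ hγ) (abs_nonneg _))
    have h2 := (ContinuousMap.isometryEquivBoundedOfCompact unitInterval
      X).toHomeomorph.isCompact_image (s := (geoVal '' Z))
    exact h2.1 key
  exact (geoVal_emb.isInducing.isCompact_iff).2 hc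

lemma exists_borel_section {Z Y : Type*} [MetricSpace Z] [CompactSpace Z] [Nonempty Z]
    [MeasurableSpace Z] [BorelSpace Z] [TopologicalSpace Y] [T2Space Y]
    [MeasurableSpace Y] [BorelSpace Y] (p : Z → Y) (hp : Continuous p) :
    ∃ g : Y → Z, Measurable g ∧ ∀ y ∈ range p, p (g y) = y := by
  classical
  obtain ⟨c, hc, hcs⟩ := exists_nat_bool_continuous_surjective_of_compact Z
  let q : cantorSet → Z := fun k => c (cantorSetHomeomorphNatToBool k)
  have hq : Continuous q := hc.comp cantorSetHomeomorphNatToBool.continuous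
  have hqs : Function.Surjective q := hcs.comp cantorSetHomeomorphNatToBool.surjective
  have hpq : Continuous (fun k => p (q k)) := hp.comp hq
  haveI : CompactSpace cantorSet := cantorSetHomeomorphNatToBool.symm.compactSpace
  -- least element of fibres
  have hmin : ∀ y ∈ range p, ∃ k : cantorSet, p (q k) = y ∧
      ∀ k' : cantorSet, p (q k') = y → (k : ℝ) ≤ k' := by
    rintro y ⟨z, rfl⟩
    obtain ⟨k, rfl⟩ := hqs z
    have hcomp : IsCompact {k' : cantorSet | p (q k') = p (q k)} :=
      (isClosed_eq hpq continuous_const).isCompact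
    obtain ⟨k0, h0, hk0⟩ := hcomp.exists_isMinOn ⟨k, rfl⟩ continuous_subtype_val.continuousOn
    exact ⟨k0, h0, fun k' hk' => hk0 hk'⟩
  obtain ⟨k0⟩ : Nonempty cantorSet := ⟨cantorSetHomeomorphNatToBool.symm (fun _ => true)⟩
  let sl : Y → cantorSet := fun y => if h : y ∈ range p then (hmin y h).choose else k0
  have hsl1 : ∀ y ∈ range p, p (q (sl y)) = y := by
    intro y h
    simp only [sl, dif_pos h]
    exact (hmin y h).choose_spec.1
  have hsl2 : ∀ y ∈ range p, ∀ k' : cantorSet, p (q k') = y → ((sl y : cantorSet) : ℝ) ≤ k' := by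
    intro y h
    simp only [sl, dif_pos h]
    exact (hmin y h).choose_spec.2
  have hrange : MeasurableSet (range p) := (isCompact_range hp).measurableSet
  have hslm : Measurable sl := by
    suffices h : Measurable (fun y => ((sl y : cantorSet) : ℝ)) from
      Measurable.subtype_mk (p := (· ∈ cantorSet)) h
    refine measurable_of_Iic fun r => ?_
    have hset : (fun y => ((sl y : cantorSet) : ℝ)) ⁻¹' Iic r =
        ((fun k => p (q k)) '' {k : cantorSet | (k : ℝ) ≤ r}) ∪
          ((range p)ᶜ ∩ {_y : Y | (k0 : ℝ) ≤ r}) := by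
      ext y
      constructor
      · intro hy
        by_cases h : y ∈ range p
        · exact Or.inl ⟨sl y, hy, hsl1 y h⟩
        · right
          refine ⟨h, ?_⟩
          have : sl y = k0 := dif_neg h
          simpa [this] using hy
      · rintro (⟨k, hk, rfl⟩ | ⟨h, hk⟩)
        · exact (hsl2 _ ⟨q k, rfl⟩ k rfl).trans hk
        · have : sl y = k0 := dif_neg h
          simpa [this] using hk
    rw [hset]
    refine MeasurableSet.union ?_ (hrange.compl.inter (MeasurableSet.const _))
    refine IsCompact.measurableSet ?_
    exact ((isClosed_le continuous_subtype_val continuous_const).isCompact).image hpq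
  refine ⟨fun y => q (sl y), hq.measurable.comp hslm, hsl1⟩

lemma sinh_mul_le {α τ : ℝ} (hα : 0 ≤ α) (h0 : 0 ≤ τ) (h1 : τ ≤ 1) :
    Real.sinh (τ * α) ≤ τ * Real.sinh α := by
  -- the function τ ↦ τ sinh α - sinh (τ α): use convexity of sinh on [0,∞)
  have hconv : ConvexOn ℝ (Ici (0 : ℝ)) Real.sinh := by
    refine convexOn_of_deriv2_nonneg (convex_Ici 0) Real.continuous_sinh.continuousOn
      Real.differentiable_sinh.differentiableOn ?_ ?_
    · rw [Real.deriv_sinh]; exact Real.differentiable_cosh.differentiableOn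
    · intro x hx
      rw [interior_Ici] at hx
      simp only [Function.iterate_succ, Function.iterate_zero, Function.comp, id]
      rw [Real.deriv_sinh, Real.deriv_cosh]
      exact Real.sinh_nonneg_iff.2 (le_of_lt hx)
  have := hconv.2 (show (0 : ℝ) ∈ Ici (0 : ℝ) by simp) (show α ∈ Ici (0 : ℝ) from hα)
    (show 0 ≤ 1 - τ by linarith) h0 (by ring)
  simpa using this

lemma sin_mul_ge {α τ : ℝ} (hα : 0 ≤ α) (hα' : α ≤ Real.pi) (h0 : 0 ≤ τ) (h1 : τ ≤ 1) :
    τ * Real.sin α ≤ Real.sin (τ * α) := by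
  have := strictConcaveOn_sin_Icc.concaveOn.2
    (show (0 : ℝ) ∈ Icc (0 : ℝ) Real.pi from ⟨le_rfl, Real.pi_pos.le⟩)
    (show α ∈ Icc (0 : ℝ) Real.pi from ⟨hα, hα'⟩)
    (show 0 ≤ 1 - τ by linarith) h0 (by ring)
  simpa using this

lemma sig_angle {K N θ : ℝ} (hN : 0 < N) (hθ : 0 ≤ θ) (h1 : ¬ N * Real.pi ^ 2 ≤ K * θ ^ 2)
    (h2 : 0 < K * θ ^ 2) : 0 < θ * Real.sqrt (K / N) ∧ θ * Real.sqrt (K / N) < Real.pi := by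
  have hθ2 : 0 < θ := by
    rcases hθ.lt_or_eq with h | h
    · exact h
    · rw [← h] at h2; simp at h2
  have hK : 0 < K := by
    by_contra h
    push Not at h
    nlinarith [mul_nonneg (neg_nonneg.2 h) (sq_nonneg θ)]
  have hs : 0 < Real.sqrt (K / N) := Real.sqrt_pos.2 (by positivity)
  refine ⟨by positivity, ?_⟩
  refine lt_of_pow_lt_pow_left₀ 2 Real.pi_pos.le ?_
  rw [mul_pow, Real.sq_sqrt (by positivity)]
  push Not at h1
  have : θ ^ 2 * (K / N) = (K * θ ^ 2) / N := by ring
  rw [this, div_lt_iff₀ hN]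
  linarith

lemma sig_angle_neg {K N θ : ℝ} (hN : 0 < N) (hθ : 0 ≤ θ) 
    (h2 : ¬ 0 < K * θ ^ 2) (h3 : ¬ K * θ ^ 2 = 0) : 0 < θ * Real.sqrt (-K / N) := by
  have hθ2 : 0 < θ := by
    rcases hθ.lt_or_eq with h | h
    · exact h
    · rw [← h] at h3; simp at h3
  have hK : K < 0 := by
    by_contra h
    push Not at h
    exact h3 (le_antisymm (not_lt.1 h2) (by positivity))
  have hs : 0 < Real.sqrt (-K / N) := Real.sqrt_pos.2 (div_pos (by linarith) hN)
  positivity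

lemma sig_pos {K N t θ : ℝ} (hN : 0 < N) (hθ : 0 ≤ θ) (ht : 0 < t) (ht1 : t ≤ 1) :
    0 < sigmaCoeff K N t θ := by
  unfold sigmaCoeff
  split_ifs with h1 h2 h3
  · simp
  · obtain ⟨ha, hb⟩ := sig_angle hN hθ h1 h2
    rw [ENNReal.ofReal_pos, mul_assoc]
    refine div_pos (Real.sin_pos_of_pos_of_lt_pi (by positivity) ?_)
      (Real.sin_pos_of_pos_of_lt_pi ha hb)
    nlinarith
  · simpa using ht
  · have ha := sig_angle_neg hN hθ h2 h3
    rw [ENNReal.ofReal_pos, mul_assoc]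
    exact div_pos (Real.sinh_pos_iff.2 (by positivity)) (Real.sinh_pos_iff.2 ha)

lemma sig_lower (K N D : ℝ) (hN : 0 < N) :
    ∃ C : ℝ, 1 ≤ C ∧ ∀ θ, 0 ≤ θ → θ ≤ D → ∀ τ, 0 ≤ τ → τ ≤ 1 →
      ENNReal.ofReal (1 - τ * C) ≤ sigmaCoeff K N (1 - τ) θ := by
  refine ⟨Real.cosh (D * Real.sqrt (-K / N)), Real.one_le_cosh _, ?_⟩
  intro θ hθ hθD τ h0 h1
  set C := Real.cosh (D * Real.sqrt (-K / N)) with hC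
  have hC1 : 1 ≤ C := Real.one_le_cosh _
  have hle : 1 - τ * C ≤ 1 - τ := by nlinarith
  unfold sigmaCoeff
  split_ifs with h2 h3 h4
  · simp
  · obtain ⟨ha, hb⟩ := sig_angle hN hθ h2 h3
    refine ENNReal.ofReal_le_ofReal (hle.trans ?_)
    rw [mul_assoc, le_div_iff₀ (Real.sin_pos_of_pos_of_lt_pi ha hb)]
    exact sin_mul_ge ha.le hb.le (by linarith) (by linarith)
  · exact ENNReal.ofReal_le_ofReal hle
  · have ha := sig_angle_neg hN hθ h3 h4
    refine ENNReal.ofReal_le_ofReal ?_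
    rw [mul_assoc]
    set α := θ * Real.sqrt (-K / N) with hα
    have hs := Real.sinh_pos_iff.2 ha
    rw [le_div_iff₀ hs]
    have e : (1 - τ) * α = α - τ * α := by ring
    rw [e, Real.sinh_sub]
    have hch : Real.cosh α ≤ C := by
      rw [hC, Real.cosh_le_cosh, abs_of_pos ha, abs_of_nonneg]
      · exact mul_le_mul_of_nonneg_right hθD (Real.sqrt_nonneg _)
      · exact mul_nonneg (hθ.trans hθD) (Real.sqrt_nonneg _)
    have h5 := sinh_mul_le ha.le h0 h1
    have h6 : 1 ≤ Real.cosh (τ * α) := Real.one_le_cosh _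
    have h7 : Real.cosh α * Real.sinh (τ * α) ≤ C * (τ * Real.sinh α) := by
      refine mul_le_mul hch h5 (Real.sinh_nonneg_iff.2 (by positivity)) (by linarith)
    nlinarith

structure DualPair (P Q : Set X) (f g : X → ℝ) (M : ℝ) : Prop where
  mP : MeasurableSet P
  mQ : MeasurableSet Q
  bdd : Bornology.IsBounded (P ∪ Q)
  mf : Measurable f
  mg : Measurable g
  hf : ∀ x ∈ P, |f x| ≤ M
  hg : ∀ y ∈ Q, |g y| ≤ M
  hfg : ∀ x ∈ P, ∀ y ∈ Q, f x + g y ≤ dist x y ^ 2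

def GSet (P Q : Set X) (f g : X → ℝ) : Set (Geo X) :=
  {γ | eval 0 γ ∈ P ∧ eval 1 γ ∈ Q ∧
    f (eval 0 γ) + g (eval 1 γ) = dist (eval 0 γ) (eval 1 γ) ^ 2}

def Good (π : Measure (Geo X)) : Prop :=
  ∃ P Q f g M, DualPair (X := X) P Q f g M ∧ ∀ᵐ γ ∂π, γ ∈ GSet P Q f g

lemma cost_lower [BorelSpace X] {P Q : Set X} {f g : X → ℝ} {M : ℝ} (h : DualPair P Q f g M)
    (π : Measure (Geo X)) [IsProbabilityMeasure π]
    (hP : ∀ᵐ γ ∂π, eval 0 γ ∈ P ∧ eval 1 γ ∈ Q) :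
    ∫⁻ x, ENNReal.ofReal (f x + M) ∂(π.map (eval 0)) + ∫⁻ x, ENNReal.ofReal (g x + M) ∂(π.map (eval 1))
      ≤ transportCost π + ENNReal.ofReal (2 * M) := by
  have m1 : Measurable (fun x => ENNReal.ofReal (f x + M)) := (h.mf.add_const _).ennreal_ofReal
  have m2 : Measurable (fun x => ENNReal.ofReal (g x + M)) := (h.mg.add_const _).ennreal_ofReal
  rw [lintegral_map m1 (measurable_geval 0), lintegral_map m2 (measurable_geval 1),
    ← lintegral_add_left (f := fun γ => ENNReal.ofReal (f (eval 0 γ) + M)) (m1.comp (measurable_geval 0))]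
  have : ENNReal.ofReal (2 * M) = ∫⁻ _γ : Geo X, ENNReal.ofReal (2 * M) ∂π := by simp
  rw [this, transportCost, ← lintegral_add_right _ measurable_const]
  refine lintegral_mono_ae ?_
  filter_upwards [hP] with γ hγ
  have h1 := abs_le.1 (h.hf _ hγ.1)
  have h2 := abs_le.1 (h.hg _ hγ.2)
  rw [← ENNReal.ofReal_add (by linarith) (by linarith),
    ← ENNReal.ofReal_add (by positivity) (by linarith)]
  refine ENNReal.ofReal_le_ofReal ?_
  linarith [h.hfg _ hγ.1 _ hγ.2]

lemma cost_eq [BorelSpace X] {P Q : Set X} {f g : X → ℝ} {M : ℝ} (h : DualPair P Q f g M)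
    (π : Measure (Geo X)) [IsProbabilityMeasure π]
    (hP : ∀ᵐ γ ∂π, γ ∈ GSet P Q f g) :
    ∫⁻ x, ENNReal.ofReal (f x + M) ∂(π.map (eval 0)) + ∫⁻ x, ENNReal.ofReal (g x + M) ∂(π.map (eval 1))
      = transportCost π + ENNReal.ofReal (2 * M) := by
  have m1 : Measurable (fun x => ENNReal.ofReal (f x + M)) := (h.mf.add_const _).ennreal_ofReal
  have m2 : Measurable (fun x => ENNReal.ofReal (g x + M)) := (h.mg.add_const _).ennreal_ofReal
  rw [lintegral_map m1 (measurable_geval 0), lintegral_map m2 (measurable_geval 1),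
    ← lintegral_add_left (f := fun γ => ENNReal.ofReal (f (eval 0 γ) + M)) (m1.comp (measurable_geval 0))]
  have : ENNReal.ofReal (2 * M) = ∫⁻ _γ : Geo X, ENNReal.ofReal (2 * M) ∂π := by simp
  rw [this, transportCost, ← lintegral_add_right _ measurable_const]
  refine lintegral_congr_ae ?_
  filter_upwards [hP] with γ hγ
  have h1 := abs_le.1 (h.hf _ hγ.1)
  have h2 := abs_le.1 (h.hg _ hγ.2.1)
  rw [← ENNReal.ofReal_add (by linarith) (by linarith),
    ← ENNReal.ofReal_add (by positivity) (by linarith)]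
  congr 1
  linarith [hγ.2.2]

lemma ends_of_map [BorelSpace X] {P Q : Set X} (hP : MeasurableSet P) (hQ : MeasurableSet Q)
    {π π' : Measure (Geo X)} (h0 : π'.map (eval 0) = π.map (eval 0))
    (h1 : π'.map (eval 1) = π.map (eval 1)) (h : ∀ᵐ γ ∂π, eval 0 γ ∈ P ∧ eval 1 γ ∈ Q) :
    ∀ᵐ γ ∂π', eval 0 γ ∈ P ∧ eval 1 γ ∈ Q := by
  have a0 : ∀ᵐ x ∂(π'.map (eval 0)), x ∈ P := by
    rw [h0]; exact (ae_map_iff (measurable_geval 0).aemeasurable hP).2 (h.mono fun γ hγ => hγ.1)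
  have a1 : ∀ᵐ x ∂(π'.map (eval 1)), x ∈ Q := by
    rw [h1]; exact (ae_map_iff (measurable_geval 1).aemeasurable hQ).2 (h.mono fun γ hγ => hγ.2)
  filter_upwards [ae_of_ae_map (measurable_geval 0).aemeasurable a0,
    ae_of_ae_map (measurable_geval 1).aemeasurable a1] with γ b0 b1 using ⟨b0, b1⟩

lemma Good.isOpt [BorelSpace X] {π : Measure (Geo X)} [IsProbabilityMeasure π] (h : Good π) :
    IsOptGeo (π.map (eval 0)) (π.map (eval 1)) π := by
  obtain ⟨P, Q, f, g, M, hd, hG⟩ := h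
  refine ⟨inferInstance, rfl, rfl, ?_⟩
  intro π' hp h0 h1
  have e1 := cost_eq hd π hG
  have e2 := cost_lower hd π' (ends_of_map hd.mP hd.mQ h0 h1 (hG.mono fun γ hγ => ⟨hγ.1, hγ.2.1⟩))
  rw [h0, h1, e1] at e2
  exact (ENNReal.add_le_add_iff_right ENNReal.ofReal_ne_top).1 e2

lemma DualPair.dist_le {P Q : Set X} {f g : X → ℝ} {M : ℝ} (h : DualPair P Q f g M) :
    ∃ D : ℝ, 0 ≤ D ∧ ∀ x ∈ P ∪ Q, ∀ y ∈ P ∪ Q, dist x y ≤ D := by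
  obtain ⟨D, hD⟩ := Metric.isBounded_iff.1 h.bdd
  exact ⟨max D 0, le_max_right _ _, fun x hx y hy => (hD hx hy).trans (le_max_left _ _)⟩

lemma measurable_cost [BorelSpace X] :
    Measurable (fun γ : Geo X => ENNReal.ofReal (dist (eval 0 γ) (eval 1 γ) ^ 2)) :=
  (((continuous_geval 0).dist (continuous_geval 1)).pow 2).measurable.ennreal_ofReal

lemma GSet_of_opt [BorelSpace X] {P Q : Set X} {f g : X → ℝ} {M : ℝ} (hd : DualPair P Q f g M)
    {π π' : Measure (Geo X)} [IsProbabilityMeasure π] [IsProbabilityMeasure π']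
    (hG : ∀ᵐ γ ∂π, γ ∈ GSet P Q f g) 
    (h : IsOptGeo (π.map (eval 0)) (π.map (eval 1)) π') :
    ∀ᵐ γ ∂π', γ ∈ GSet P Q f g := by
  obtain ⟨_, h0, h1, hmin⟩ := h
  have hc := hmin π inferInstance rfl rfl
  have hends := ends_of_map hd.mP hd.mQ h0 h1 (hG.mono fun γ hγ => ⟨hγ.1, hγ.2.1⟩)
  obtain ⟨D, hD0, hD⟩ := hd.dist_le
  have hfin : transportCost π' ≠ ⊤ := by
    refine ne_of_lt (lt_of_le_of_lt (b := ENNReal.ofReal (D ^ 2)) ?_ ENNReal.ofReal_lt_top)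
    calc transportCost π' ≤ ∫⁻ _γ, ENNReal.ofReal (D ^ 2) ∂π' := by
          refine lintegral_mono_ae ?_
          filter_upwards [hends] with γ hγ
          refine ENNReal.ofReal_le_ofReal (pow_le_pow_left₀ dist_nonneg ?_ 2)
          exact hD _ (Or.inl hγ.1) _ (Or.inr hγ.2)
      _ = ENNReal.ofReal (D ^ 2) := by simp
  have e1 := cost_eq hd π hG
  have e2 := cost_lower hd π' hends
  have m1 : Measurable (fun x => ENNReal.ofReal (f x + M)) := (hd.mf.add_const _).ennreal_ofReal
  have m2 : Measurable (fun x => ENNReal.ofReal (g x + M)) := (hd.mg.add_const _).ennreal_ofReal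
  have hle : transportCost π' + ENNReal.ofReal (2 * M) ≤
      ∫⁻ x, ENNReal.ofReal (f x + M) ∂(π'.map (eval 0)) +
        ∫⁻ x, ENNReal.ofReal (g x + M) ∂(π'.map (eval 1)) := by
    rw [h0, h1, e1]; gcongr
  have hfin2 := lt_of_le_of_lt e2 (ENNReal.add_lt_top.2 ⟨hfin.lt_top, ENNReal.ofReal_lt_top⟩)
  rw [lintegral_map m1 (measurable_geval 0), lintegral_map m2 (measurable_geval 1),
    ← lintegral_add_left (f := fun γ => ENNReal.ofReal (f (eval 0 γ) + M)) (m1.comp (measurable_geval 0))] at hle hfin2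
  have : ENNReal.ofReal (2 * M) = ∫⁻ _γ : Geo X, ENNReal.ofReal (2 * M) ∂π' := by simp
  rw [this, transportCost, ← lintegral_add_right _ measurable_const] at hle
  have key := ae_eq_of_ae_le_of_lintegral_le (μ := π') ?_ hfin2.ne ?_ hle
  · filter_upwards [key, hends] with γ h3 hγ
    have h1 := abs_le.1 (hd.hf _ hγ.1)
    have h2 := abs_le.1 (hd.hg _ hγ.2)
    rw [← ENNReal.ofReal_add (by linarith) (by linarith),
      ← ENNReal.ofReal_add (by positivity) (by linarith),
      ENNReal.ofReal_eq_ofReal_iff (by linarith) (by nlinarith [sq_nonneg (dist (eval 0 γ) (eval 1 γ))])] at h3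
    exact ⟨hγ.1, hγ.2, by linarith⟩
  · filter_upwards [hends] with γ hγ
    have h1 := abs_le.1 (hd.hf _ hγ.1)
    have h2 := abs_le.1 (hd.hg _ hγ.2)
    rw [← ENNReal.ofReal_add (by linarith) (by linarith),
      ← ENNReal.ofReal_add (by positivity) (by linarith)]
    refine ENNReal.ofReal_le_ofReal ?_
    linarith [hd.hfg _ hγ.1 _ hγ.2]
  · exact (measurable_cost.add_const _).aemeasurable

lemma Good.mono {π π' : Measure (Geo X)} (h : Good π) (hac : π' ≪ π) : Good π' := by
  obtain ⟨P, Q, f, g, M, hd, hG⟩ := h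
  exact ⟨P, Q, f, g, M, hd, hac.ae_le hG⟩

lemma pot_ineq {b D a e : ℝ} (hb0 : 0 ≤ b) (hb1 : b ≤ 1) (he : 0 ≤ e) (h : e ≤ a + (1 - b) * D) :
    b * e ^ 2 - a ^ 2 ≤ b * D ^ 2 - b ^ 2 * D ^ 2 := by
  have h1 : e ^ 2 ≤ (a + (1 - b) * D) ^ 2 := pow_le_pow_left₀ he h 2
  have h2 : b * e ^ 2 ≤ b * (a + (1 - b) * D) ^ 2 := mul_le_mul_of_nonneg_left h1 hb0
  nlinarith [mul_nonneg (sub_nonneg.2 hb1) (sq_nonneg (a - b * D))]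

def cinf (P : Set X) (f : X → ℝ) (z : X) : ℝ := ⨅ x : P, (dist (x : X) z ^ 2 - f x)

lemma cinf_bdd {P : Set X} {f : X → ℝ} {M : ℝ} (hf : ∀ x ∈ P, |f x| ≤ M) (z : X) :
    BddBelow (range fun x : P => (dist (x : X) z ^ 2 - f x)) := by
  refine ⟨-M, ?_⟩
  rintro _ ⟨x, rfl⟩
  have := (abs_le.1 (hf x x.2)).2
  show -M ≤ dist (x : X) z ^ 2 - f x
  nlinarith [sq_nonneg (dist (x : X) z)]

lemma cinf_le {P : Set X} {f : X → ℝ} {M : ℝ} (hf : ∀ x ∈ P, |f x| ≤ M) {x : X} (hx : x ∈ P)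
    (z : X) : cinf P f z ≤ dist x z ^ 2 - f x := ciInf_le (cinf_bdd hf z) ⟨x, hx⟩

lemma le_cinf {P : Set X} (hP : P.Nonempty) {f : X → ℝ} {c : ℝ} {z : X}
    (h : ∀ x ∈ P, c ≤ dist x z ^ 2 - f x) : c ≤ cinf P f z := by
  haveI := hP.to_subtype
  exact le_ciInf fun x => h x x.2

lemma cinf_meas [BorelSpace X] {P : Set X} {f : X → ℝ} {M : ℝ} (hf : ∀ x ∈ P, |f x| ≤ M) :
    Measurable (cinf P f) := by
  have : UpperSemicontinuous (cinf P f) := by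
    refine upperSemicontinuous_ciInf (cinf_bdd hf) fun x => Continuous.upperSemicontinuous ?_
    fun_prop
  exact this.measurable

lemma cinf_abs {P : Set X} (hP : P.Nonempty) {f : X → ℝ} {M D : ℝ} (hf : ∀ x ∈ P, |f x| ≤ M)
    {z : X} (hD : ∀ x ∈ P, dist x z ≤ D) : |cinf P f z| ≤ M + D ^ 2 := by
  obtain ⟨x, hx⟩ := hP
  have h1 := abs_le.1 (hf x hx)
  have h3 : dist x z ^ 2 ≤ D ^ 2 := pow_le_pow_left₀ dist_nonneg (hD x hx) 2
  refine abs_le.2 ⟨?_, ?_⟩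
  · refine le_cinf ⟨x, hx⟩ fun x' hx' => ?_
    have := abs_le.1 (hf x' hx')
    nlinarith [sq_nonneg (dist x' z), sq_nonneg D]
  · refine (cinf_le hf hx z).trans ?_
    linarith

/-- pointwise equality for the interpolated potential -/
lemma cinf_eq {P : Set X} {f : X → ℝ} {M b G : ℝ} (hb0 : 0 ≤ b) (hb1 : b ≤ 1)
    (hf : ∀ x ∈ P, |f x| ≤ M) {x y z : X} (hx : x ∈ P)
    (hG : ∀ x' ∈ P, f x' + G ≤ dist x' y ^ 2) (hxy : f x + G = dist x y ^ 2)
    (hxz : dist x z = b * dist x y) (hzy : dist z y = (1 - b) * dist x y) :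
    b * f x + cinf P (fun x => b * f x) z = dist x z ^ 2 := by
  have hM : 0 ≤ M := (abs_nonneg _).trans (hf x hx)
  have hbf : ∀ x ∈ P, |b * f x| ≤ M := by
    intro x hx
    rw [abs_mul, abs_of_nonneg hb0]
    nlinarith [abs_nonneg (f x), hf x hx]
  have h1 := cinf_le hbf hx z
  have h2 : dist x z ^ 2 - b * f x ≤ cinf P (fun x => b * f x) z := by
    refine le_cinf ⟨x, hx⟩ fun x' hx' => ?_
    have h3 := pot_ineq (D := dist x y) (a := dist x' z) hb0 hb1 (dist_nonneg (x := x') (y := y))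
      (by rw [← hzy]; exact dist_triangle _ _ _)
    have h4 := mul_le_mul_of_nonneg_left (hG x' hx') hb0
    rw [hxz]
    nlinarith
  linarith

lemma measurableSet_GSet [BorelSpace X] {P Q : Set X} {f g : X → ℝ} {M : ℝ}
    (h : DualPair P Q f g M) : MeasurableSet (GSet P Q f g) := by
  refine ((measurable_geval 0) h.mP).inter (((measurable_geval 1) h.mQ).inter ?_)
  refine measurableSet_eq_fun ?_ ?_
  · exact (h.mf.comp (measurable_geval 0)).add (h.mg.comp (measurable_geval 1))
  · exact (((continuous_geval 0).dist (continuous_geval 1)).pow 2).measurable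

lemma measurable_restrGeo (a b : unitInterval) : Measurable (restrGeo a b : Geo X → Geo X) :=
  (continuous_restrGeo a b).measurable

lemma Good.restr_left [BorelSpace X] {π : Measure (Geo X)} [IsProbabilityMeasure π] (h : Good π)
    (b : unitInterval) : Good (π.map (restrGeo 0 b)) := by
  obtain ⟨P, Q, f, g, M, hd, hG⟩ := h
  obtain ⟨γ₀, hγ₀⟩ := hG.exists
  obtain ⟨D, hD0, hD⟩ := hd.dist_le
  set x₁ := eval 0 γ₀
  have hx₁ : x₁ ∈ P := hγ₀.1
  have hM : 0 ≤ M := (abs_nonneg _).trans (hd.hf _ hx₁)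
  have hbf : ∀ x ∈ P, |(b : ℝ) * f x| ≤ M := by
    intro x hx
    rw [abs_mul, abs_of_nonneg b.2.1]
    nlinarith [abs_nonneg (f x), hd.hf x hx, b.2.1, b.2.2]
  have hd' : DualPair P (closedBall x₁ (2 * D)) (fun x => (b : ℝ) * f x)
      (cinf P (fun x => (b : ℝ) * f x)) (M + (3 * D) ^ 2) := by
    refine ⟨hd.mP, measurableSet_closedBall, ?_, hd.mf.const_mul _, cinf_meas hbf, ?_, ?_, ?_⟩
    · exact (hd.bdd.subset subset_union_left).union isBounded_closedBall
    · intro x hx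
      exact (hbf x hx).trans (by nlinarith)
    · intro y hy
      refine cinf_abs ⟨x₁, hx₁⟩ hbf fun x hx => ?_
      have h1 := hD x (Or.inl hx) x₁ (Or.inl hx₁)
      have h2 := dist_triangle x x₁ y
      rw [mem_closedBall'] at hy
      linarith
    · intro x hx y hy
      linarith [cinf_le hbf hx y]
  refine ⟨_, _, _, _, _, hd', ?_⟩
  refine (ae_map_iff (measurable_restrGeo 0 b).aemeasurable (measurableSet_GSet hd')).2 ?_
  filter_upwards [hG] with γ hγ
  have e0 : eval 0 (restrGeo 0 b γ) = eval 0 γ := by rw [eval_restrGeo, restrPt_zero]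
  have e1 : eval 1 (restrGeo 0 b γ) = eval b γ := by rw [eval_restrGeo, restrPt_one]
  have hb0 := b.2.1
  have hb1 := b.2.2
  have d0 : dist (eval 0 γ) (eval b γ) = b * dist (eval 0 γ) (eval 1 γ) := by
    rw [geo_dist γ 0 b]; simp [abs_of_nonneg hb0]
  have d1 : dist (eval b γ) (eval 1 γ) = (1 - b) * dist (eval 0 γ) (eval 1 γ) := by
    rw [geo_dist γ b 1, abs_sub_comm]; simp only [Set.Icc.coe_one]
    rw [abs_of_nonneg (by linarith)]
  refine ⟨by rw [e0]; exact hγ.1, ?_, ?_⟩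
  · rw [e1, mem_closedBall']
    have h1 := hD x₁ (Or.inl hx₁) _ (Or.inl hγ.1)
    have h2 := dist_triangle x₁ (eval 0 γ) (eval b γ)
    have h3 := hD _ (Or.inl hγ.1) _ (Or.inr hγ.2.1)
    nlinarith [dist_nonneg (x := eval 0 γ) (y := eval 1 γ)]
  · rw [e0, e1]
    exact cinf_eq hb0 hb1 hd.hf hγ.1 (fun x' hx' => hd.hfg x' hx' _ hγ.2.1) hγ.2.2 d0 d1

lemma Good.restr_right [BorelSpace X] {π : Measure (Geo X)} [IsProbabilityMeasure π] (h : Good π)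
    (a : unitInterval) : Good (π.map (restrGeo a 1)) := by
  obtain ⟨P, Q, f, g, M, hd, hG⟩ := h
  obtain ⟨γ₀, hγ₀⟩ := hG.exists
  obtain ⟨D, hD0, hD⟩ := hd.dist_le
  set x₁ := eval 1 γ₀
  have hx₁ : x₁ ∈ Q := hγ₀.2.1
  have hM : 0 ≤ M := (abs_nonneg _).trans (hd.hg _ hx₁)
  have ha0 := a.2.1
  have ha1 := a.2.2
  have hbf : ∀ x ∈ Q, |(1 - a : ℝ) * g x| ≤ M := by
    intro x hx
    rw [abs_mul, abs_of_nonneg (by linarith)]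
    nlinarith [abs_nonneg (g x), hd.hg x hx]
  have hd' : DualPair (closedBall x₁ (2 * D)) Q (cinf Q (fun x => (1 - a : ℝ) * g x))
      (fun x => (1 - a : ℝ) * g x) (M + (3 * D) ^ 2) := by
    refine ⟨measurableSet_closedBall, hd.mQ, ?_, cinf_meas hbf, hd.mg.const_mul _, ?_, ?_, ?_⟩
    · exact isBounded_closedBall.union (hd.bdd.subset subset_union_right)
    · intro y hy
      refine cinf_abs ⟨x₁, hx₁⟩ hbf fun x hx => ?_
      have h1 := hD x (Or.inr hx) x₁ (Or.inr hx₁)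
      have h2 := dist_triangle x x₁ y
      rw [mem_closedBall'] at hy
      linarith
    · intro x hx
      exact (hbf x hx).trans (by nlinarith)
    · intro x hx y hy
      rw [dist_comm]
      linarith [cinf_le hbf hy x]
  refine ⟨_, _, _, _, _, hd', ?_⟩
  refine (ae_map_iff (measurable_restrGeo a 1).aemeasurable (measurableSet_GSet hd')).2 ?_
  filter_upwards [hG] with γ hγ
  have e0 : eval 0 (restrGeo a 1 γ) = eval a γ := by rw [eval_restrGeo, restrPt_zero]
  have e1 : eval 1 (restrGeo a 1 γ) = eval 1 γ := by rw [eval_restrGeo, restrPt_one]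
  have d0 : dist (eval a γ) (eval 0 γ) = (1 - (1 - a)) * dist (eval 1 γ) (eval 0 γ) := by
    rw [geo_dist γ a 0, dist_comm (eval 1 γ)]; simp [abs_of_nonneg ha0]
  have d1 : dist (eval 1 γ) (eval a γ) = (1 - a) * dist (eval 1 γ) (eval 0 γ) := by
    rw [geo_dist γ 1 a, dist_comm (eval 1 γ)]; simp only [Set.Icc.coe_one]
    rw [abs_of_nonneg (by linarith)]
  refine ⟨?_, by rw [e1]; exact hγ.2.1, ?_⟩
  · rw [e0, mem_closedBall']
    have h1 := hD x₁ (Or.inr hx₁) _ (Or.inr hγ.2.1)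
    have h2 := dist_triangle x₁ (eval 1 γ) (eval a γ)
    have h3 := hD _ (Or.inr hγ.2.1) _ (Or.inl hγ.1)
    nlinarith [dist_nonneg (x := eval 1 γ) (y := eval 0 γ)]
  · rw [e0, e1, add_comm, dist_comm]
    refine cinf_eq (G := f (eval 0 γ)) (by linarith) (by linarith) hd.hg hγ.2.1 (fun x' hx' => ?_) ?_ d1 d0
    · rw [add_comm, dist_comm]; exact hd.hfg _ hγ.1 x' hx'
    · rw [add_comm, dist_comm]; exact hγ.2.2

lemma Good.dist_le {π : Measure (Geo X)} (h : Good π) :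
    ∃ D : ℝ, 0 ≤ D ∧ ∀ᵐ γ ∂π, dist (eval 0 γ) (eval 1 γ) ≤ D := by
  obtain ⟨P, Q, f, g, M, hd, hG⟩ := h
  obtain ⟨D, hD0, hD⟩ := hd.dist_le
  exact ⟨D, hD0, hG.mono fun γ hγ => hD _ (Or.inl hγ.1) _ (Or.inr hγ.2.1)⟩

def CDIneq (K N' : ℝ) (m : Measure X) (π : Measure (Geo X)) (t : unitInterval) : Prop :=
  ∫⁻ γ, (sigmaCoeff K N' (1 - (t : ℝ)) (dist (eval 0 γ) (eval 1 γ)) *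
                 ((π.map (eval 0)).rnDeriv m (eval 0 γ)) ^ (-(1 / N')) +
               sigmaCoeff K N' (t : ℝ) (dist (eval 0 γ) (eval 1 γ)) *
                 ((π.map (eval 1)).rnDeriv m (eval 1 γ)) ^ (-(1 / N'))) ∂π
          ≤ ∫⁻ x, ((π.map (eval t)).rnDeriv m x) ^ (1 - 1 / N') ∂m

lemma second_moment_of_bdd {μ : Measure X} [IsProbabilityMeasure μ] {s : Set X}
    (hs : Bornology.IsBounded s) (h : ∀ᵐ x ∂μ, x ∈ s) : HasFiniteSecondMoment μ := by
  obtain ⟨x₀, hx₀⟩ := h.exists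
  obtain ⟨D, hD⟩ := Metric.isBounded_iff.1 hs
  refine ⟨x₀, ne_of_lt (lt_of_le_of_lt (b := ENNReal.ofReal (D ^ 2)) ?_ ENNReal.ofReal_lt_top)⟩
  calc ∫⁻ x, ENNReal.ofReal (dist x x₀ ^ 2) ∂μ ≤ ∫⁻ _x, ENNReal.ofReal (D ^ 2) ∂μ := by
        refine lintegral_mono_ae ?_
        filter_upwards [h] with x hx
        exact ENNReal.ofReal_le_ofReal (pow_le_pow_left₀ dist_nonneg (hD hx hx₀) 2)
    _ = _ := by simp

lemma Good.ends {π : Measure (Geo X)} [BorelSpace X] (h : Good π) :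
    ∃ s : Set X, MeasurableSet s ∧ Bornology.IsBounded s ∧
      (∀ᵐ x ∂(π.map (eval 0)), x ∈ s) ∧ ∀ᵐ x ∂(π.map (eval 1)), x ∈ s := by
  obtain ⟨P, Q, f, g, M, hd, hG⟩ := h
  refine ⟨P ∪ Q, hd.mP.union hd.mQ, hd.bdd, ?_, ?_⟩
  · exact (ae_map_iff (measurable_geval 0).aemeasurable (hd.mP.union hd.mQ)).2
      (hG.mono fun γ hγ => Or.inl hγ.1)
  · exact (ae_map_iff (measurable_geval 1).aemeasurable (hd.mP.union hd.mQ)).2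
      (hG.mono fun γ hγ => Or.inr hγ.2.1)

lemma cd_of_good [BorelSpace X] {m : Measure X} {K N : ℝ} (hCD : IsCDStar K N m)
    (hGT : GoodTransport m) {π : Measure (Geo X)} [IsProbabilityMeasure π] (h : Good π)
    (h0 : π.map (eval 0) ≪ m) (h1 : π.map (eval 1) ≪ m) (t : unitInterval) (N' : ℝ)
    (hN' : N ≤ N') : CDIneq K N' m π t := by
  obtain ⟨s, hsm, hsb, hs0, hs1⟩ := h.ends
  have i0 : IsProbabilityMeasure (π.map (eval 0)) :=
    Measure.isProbabilityMeasure_map (measurable_geval 0).aemeasurable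
  have i1 : IsProbabilityMeasure (π.map (eval 1)) :=
    Measure.isProbabilityMeasure_map (measurable_geval 1).aemeasurable
  obtain ⟨π', hopt, hineq⟩ := hCD (π.map (eval 0)) (π.map (eval 1)) i0 i1 ⟨s, hsb, hs0, hs1⟩
  obtain ⟨π₀, _, hu⟩ := (hGT (π.map (eval 0)) (π.map (eval 1)) i0 i1
    (second_moment_of_bdd hsb hs0) (second_moment_of_bdd hsb hs1) h0 h1).1
  have : π' = π := (hu π' hopt).trans (hu π h.isOpt).symm
  subst this
  exact hineq t N' hN'

lemma measurable_sigmaCoeff (K N t : ℝ) : Measurable (sigmaCoeff K N t) := by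
  unfold sigmaCoeff
  refine Measurable.ite (measurableSet_le (by fun_prop) (by fun_prop)) (by fun_prop) ?_
  refine Measurable.ite (measurableSet_lt (by fun_prop) (by fun_prop)) ?_ ?_
  · exact Measurable.ennreal_ofReal (by fun_prop)
  refine Measurable.ite (measurableSet_eq_fun (by fun_prop) (by fun_prop)) (by fun_prop) ?_
  exact Measurable.ennreal_ofReal (by fun_prop)

/-- If the CD inequality holds then the intermediate measure is not singular. -/
lemma rnDeriv_ne_zero_of_cd [BorelSpace X] {m : Measure X} [SigmaFinite m] {K N' : ℝ} (hN' : 2 ≤ N')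
    {π : Measure (Geo X)} [IsProbabilityMeasure π] (h0 : π.map (eval 0) ≪ m)
    (t : unitInterval) (ht : (t : ℝ) < 1) (h : CDIneq K N' m π t) :
    ¬ (π.map (eval t)).rnDeriv m =ᵐ[m] 0 := by
  intro hz
  have i0 : IsProbabilityMeasure (π.map (eval 0)) :=
    Measure.isProbabilityMeasure_map (measurable_geval 0).aemeasurable
  have hp : 0 < 1 - 1 / N' := by
    rw [sub_pos, div_lt_one (by linarith)]; linarith
  have hr : ∫⁻ x, ((π.map (eval t)).rnDeriv m x) ^ (1 - 1 / N') ∂m = 0 := by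
    rw [← lintegral_zero (μ := m)]
    refine lintegral_congr_ae ?_
    filter_upwards [hz] with x hx
    rw [hx]; simp only [Pi.zero_apply]; exact ENNReal.zero_rpow_of_pos hp
  unfold CDIneq at h
  rw [hr, nonpos_iff_eq_zero] at h
  have hlt : ∀ᵐ γ ∂π, (π.map (eval 0)).rnDeriv m (eval 0 γ) < ⊤ :=
    ae_of_ae_map (measurable_geval 0).aemeasurable
      (h0.ae_le (Measure.rnDeriv_lt_top (π.map (eval 0)) m))
  have hms : Measurable (fun γ : Geo X => sigmaCoeff K N' (1 - (t : ℝ)) (dist (eval 0 γ) (eval 1 γ))) :=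
    (measurable_sigmaCoeff K N' (1 - (t : ℝ))).comp
      ((continuous_geval 0).dist (continuous_geval 1)).measurable
  have hmr : Measurable (fun γ : Geo X => ((π.map (eval 0)).rnDeriv m (eval 0 γ)) ^ (-(1 / N'))) :=
    ((Measure.measurable_rnDeriv _ _).comp (measurable_geval 0)).pow_const _
  rw [lintegral_add_left (f := fun γ : Geo X => sigmaCoeff K N' (1 - (t : ℝ))
    (dist (eval 0 γ) (eval 1 γ)) * ((π.map (eval 0)).rnDeriv m (eval 0 γ)) ^ (-(1 / N')))
    (hms.mul hmr)] at h
  have h1 := (lintegral_eq_zero_iff (hms.mul hmr)).1 (add_eq_zero.1 h).1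
  obtain ⟨γ, hγ1, hγ2⟩ := (h1.and hlt).exists
  simp only [Pi.zero_apply] at hγ1
  rcases mul_eq_zero.1 hγ1 with h' | h'
  · exact (sig_pos (by linarith) dist_nonneg (by linarith) (by linarith [t.2.1])).ne' h'
  · rw [ENNReal.rpow_eq_zero_iff] at h'
    rcases h' with h' | h'
    · have : 0 < 1 / N' := by positivity
      linarith
    · exact hγ2.ne h'.1

lemma ac_mid [BorelSpace X] {m : Measure X} [SigmaFinite m] {K N : ℝ} (hN : 1 ≤ N)
    (hCD : IsCDStar K N m)
    (hGT : GoodTransport m) {π : Measure (Geo X)} [IsProbabilityMeasure π] (h : Good π)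
    (h0 : π.map (eval 0) ≪ m) (h1 : π.map (eval 1) ≪ m) (t : unitInterval) :
    π.map (eval t) ≪ m := by
  refine Measure.AbsolutelyContinuous.mk fun s hs hms => ?_
  by_contra hne
  rcases t.2.2.lt_or_eq with ht | ht
  swap
  · have : t = 1 := Subtype.ext ht
    subst this
    exact hne (h1 hms)
  rw [Measure.map_apply (measurable_geval t) hs] at hne
  set A : Set (Geo X) := eval t ⁻¹' s
  have hA : MeasurableSet A := measurable_geval t hs
  haveI : IsProbabilityMeasure (ProbabilityTheory.cond π A) :=
    ProbabilityTheory.cond_isProbabilityMeasure hne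
  have hac : ProbabilityTheory.cond π A ≪ π := ProbabilityTheory.cond_absolutelyContinuous
  have k0 := (hac.map (measurable_geval 0)).trans h0
  have k1 := (hac.map (measurable_geval 1)).trans h1
  refine rnDeriv_ne_zero_of_cd (K := K) (N' := N + 1) (by linarith) k0 t ht
    (cd_of_good hCD hGT (h.mono hac) k0 k1 t (N + 1) (by linarith)) ?_
  haveI : IsProbabilityMeasure ((ProbabilityTheory.cond π A).map (eval t)) :=
    Measure.isProbabilityMeasure_map (measurable_geval t).aemeasurable
  refine (Measure.rnDeriv_eq_zero _ _).2 ⟨sᶜ, hs.compl, ?_, by rwa [compl_compl]⟩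
  rw [Measure.map_apply (measurable_geval t) hs.compl, ProbabilityTheory.cond_apply hA]
  have : A ∩ eval t ⁻¹' sᶜ = ∅ := by
    ext γ; simp [A]
  rw [this]; simp

def UF (p : ℝ) (m μ : Measure X) : ℝ≥0∞ := ∫⁻ x, (μ.rnDeriv m x) ^ p ∂m

lemma lintegral_inv_density {m μ : Measure X} [SigmaFinite m] [IsProbabilityMeasure μ] (h : μ ≪ m)
    {N' : ℝ} (hN' : 2 ≤ N') :
    ∫⁻ x, (μ.rnDeriv m x) ^ (-(1 / N')) ∂μ = UF (1 - 1 / N') m μ := by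
  have hp : 0 < 1 - 1 / N' := by
    rw [sub_pos, div_lt_one (by linarith)]; linarith
  have hm : Measurable (μ.rnDeriv m) := Measure.measurable_rnDeriv _ _
  conv_lhs => rw [← Measure.withDensity_rnDeriv_eq μ m h]
  rw [Measure.withDensity_rnDeriv_eq μ m h, UF]
  conv_lhs => enter [1]; rw [← Measure.withDensity_rnDeriv_eq μ m h]
  rw [lintegral_withDensity_eq_lintegral_mul _ hm (hm.pow_const _)]
  refine lintegral_congr_ae ?_
  filter_upwards [Measure.rnDeriv_lt_top μ m] with x hx
  simp only [Pi.mul_apply]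
  rcases eq_or_ne (μ.rnDeriv m x) 0 with h0 | h0
  · rw [h0, zero_mul, ENNReal.zero_rpow_of_pos hp]
  · conv_lhs => enter [1]; rw [← ENNReal.rpow_one (μ.rnDeriv m x)]
    rw [← ENNReal.rpow_add _ _ h0 hx.ne]
    rfl

lemma UF_left [BorelSpace X] {m : Measure X} [SigmaFinite m] {K N' C D : ℝ} (hN' : 2 ≤ N')
    (hC : ∀ θ : ℝ, 0 ≤ θ → θ ≤ D → ∀ τ : ℝ, 0 ≤ τ → τ ≤ 1 →
      ENNReal.ofReal (1 - τ * C) ≤ sigmaCoeff K N' (1 - τ) θ)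
    {π : Measure (Geo X)} [IsProbabilityMeasure π] (hD : ∀ᵐ γ ∂π, dist (eval 0 γ) (eval 1 γ) ≤ D)
    (h0 : π.map (eval 0) ≪ m) {t : unitInterval} (h : CDIneq K N' m π t) :
    ENNReal.ofReal (1 - t * C) * UF (1 - 1 / N') m (π.map (eval 0)) ≤
      UF (1 - 1 / N') m (π.map (eval t)) := by
  haveI : IsProbabilityMeasure (π.map (eval 0)) :=
    Measure.isProbabilityMeasure_map (measurable_geval 0).aemeasurable
  refine le_trans ?_ h
  rw [← lintegral_inv_density h0 hN', lintegral_map ((Measure.measurable_rnDeriv _ _).pow_const _)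
    (measurable_geval 0), ← lintegral_const_mul' _ _ ENNReal.ofReal_ne_top]
  refine lintegral_mono_ae ?_
  filter_upwards [hD] with γ hγ
  exact le_trans (by gcongr; exact hC _ dist_nonneg hγ _ t.2.1 t.2.2) le_self_add

lemma UF_right [BorelSpace X] {m : Measure X} [SigmaFinite m] {K N' C D : ℝ} (hN' : 2 ≤ N')
    (hC : ∀ θ : ℝ, 0 ≤ θ → θ ≤ D → ∀ τ : ℝ, 0 ≤ τ → τ ≤ 1 →
      ENNReal.ofReal (1 - τ * C) ≤ sigmaCoeff K N' (1 - τ) θ)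
    {π : Measure (Geo X)} [IsProbabilityMeasure π] (hD : ∀ᵐ γ ∂π, dist (eval 0 γ) (eval 1 γ) ≤ D)
    (h1 : π.map (eval 1) ≪ m) {t : unitInterval} (h : CDIneq K N' m π t) :
    ENNReal.ofReal (1 - (1 - t) * C) * UF (1 - 1 / N') m (π.map (eval 1)) ≤
      UF (1 - 1 / N') m (π.map (eval t)) := by
  haveI : IsProbabilityMeasure (π.map (eval 1)) :=
    Measure.isProbabilityMeasure_map (measurable_geval 1).aemeasurable
  refine le_trans ?_ h
  rw [← lintegral_inv_density h1 hN', lintegral_map ((Measure.measurable_rnDeriv _ _).pow_const _)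
    (measurable_geval 1), ← lintegral_const_mul' _ _ ENNReal.ofReal_ne_top]
  refine lintegral_mono_ae ?_
  filter_upwards [hD] with γ hγ
  refine le_trans ?_ le_add_self
  gcongr
  have := hC _ dist_nonneg hγ (1 - t) (by linarith [t.2.2]) (by linarith [t.2.1])
  rwa [_root_.sub_sub_cancel] at this

lemma UF_le {m μ : Measure X} [SigmaFinite m] [IsProbabilityMeasure μ] (h : μ ≪ m)
    {N' : ℝ} (hN' : 2 ≤ N') {s : Set X} (hs : MeasurableSet s) (hμ : μ sᶜ = 0) :
    UF (1 - 1 / N') m μ ≤ (m s) ^ (1 / N') := by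
  have hp : 0 < 1 - 1 / N' := by
    rw [sub_pos, div_lt_one (by linarith)]; linarith
  have hq : 0 < 1 / N' := by positivity
  have hm : Measurable (μ.rnDeriv m) := Measure.measurable_rnDeriv _ _
  have hz : ∀ᵐ x ∂m, x ∈ sᶜ → μ.rnDeriv m x = 0 := by
    have : ∫⁻ x in sᶜ, μ.rnDeriv m x ∂m = 0 := by
      rw [Measure.setLIntegral_rnDeriv h, hμ]
    rw [lintegral_eq_zero_iff hm] at this
    exact (ae_restrict_iff' hs.compl).1 this
  have := ENNReal.lintegral_mul_norm_pow_le (μ := m) (f := μ.rnDeriv m) (g := s.indicator 1)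
    hm.aemeasurable (measurable_one.indicator hs).aemeasurable hp.le hq.le (by ring)
  rw [lintegral_indicator_one hs, Measure.lintegral_rnDeriv h, measure_univ, ENNReal.one_rpow,
    one_mul] at this
  refine le_trans ?_ this
  refine lintegral_mono_ae ?_
  filter_upwards [hz] with x hx
  by_cases hxs : x ∈ s
  · simp [hxs]
  · rw [hx hxs, ENNReal.zero_rpow_of_pos hp]; exact zero_le

lemma UF_ne_zero {m μ : Measure X} [SigmaFinite m] [IsProbabilityMeasure μ] (h : μ ≪ m)
    {p : ℝ} (hp : 0 < p) : UF p m μ ≠ 0 := by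
  intro hz
  have hm : Measurable (μ.rnDeriv m) := Measure.measurable_rnDeriv _ _
  rw [UF, lintegral_eq_zero_iff (hm.pow_const _)] at hz
  have h2 : ∫⁻ x, μ.rnDeriv m x ∂m = 0 := by
    rw [lintegral_eq_zero_iff hm]
    filter_upwards [hz] with x hx
    exact (ENNReal.rpow_eq_zero_iff_of_pos hp).1 hx
  rw [Measure.lintegral_rnDeriv h, measure_univ] at h2
  exact one_ne_zero h2

lemma UF_mix {m α β : Measure X} [SigmaFinite m] [IsProbabilityMeasure α] [IsProbabilityMeasure β]
    (ha : α ≪ m) (hb : β ≪ m) (hs : α ⟂ₘ β) {p : ℝ} (hp : 0 < p) :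
    UF p m ((2⁻¹ : ℝ≥0∞) • (α + β)) = (2⁻¹ : ℝ≥0∞) ^ p * (UF p m α + UF p m β) := by
  obtain ⟨s, hs, h1, h2⟩ := hs
  have ma : Measurable (α.rnDeriv m) := Measure.measurable_rnDeriv _ _
  have mb : Measurable (β.rnDeriv m) := Measure.measurable_rnDeriv _ _
  have hza : ∀ᵐ x ∂m, x ∈ s → α.rnDeriv m x = 0 := by
    have : ∫⁻ x in s, α.rnDeriv m x ∂m = 0 := by
      rw [Measure.setLIntegral_rnDeriv ha, h1]
    rw [lintegral_eq_zero_iff ma] at this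
    exact (ae_restrict_iff' hs).1 this
  have hzb : ∀ᵐ x ∂m, x ∈ sᶜ → β.rnDeriv m x = 0 := by
    have : ∫⁻ x in sᶜ, β.rnDeriv m x ∂m = 0 := by
      rw [Measure.setLIntegral_rnDeriv hb, h2]
    rw [lintegral_eq_zero_iff mb] at this
    exact (ae_restrict_iff' hs.compl).1 this
  unfold UF
  rw [← lintegral_add_left (ma.pow_const p), ← lintegral_const_mul]
  swap
  · exact (ma.pow_const p).add (mb.pow_const p)
  refine lintegral_congr_ae ?_
  have e1 := Measure.rnDeriv_smul_left_of_ne_top' (α + β) m (r := (2⁻¹ : ℝ≥0∞)) (by simp)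
  have e2 := Measure.rnDeriv_add' α β m
  filter_upwards [e1, e2, hza, hzb] with x h1 h2 h3 h4
  rw [h1, Pi.smul_apply, h2, Pi.add_apply, smul_eq_mul, ENNReal.mul_rpow_of_nonneg _ _ hp.le]
  congr 1
  by_cases hx : x ∈ s
  · rw [h3 hx, ENNReal.zero_rpow_of_pos hp, zero_add, zero_add]
  · rw [h4 hx, ENNReal.zero_rpow_of_pos hp, add_zero, add_zero]

lemma reweight {Y Z : Type*} [MeasurableSpace Y] [MeasurableSpace Z] (π : Measure Y)
    [IsFiniteMeasure π] {e : Y → Z} (he : Measurable e) (κ : Measure Z) [IsProbabilityMeasure κ]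
    (h : κ ≪ π.map e) : ∃ π' : Measure Y, IsProbabilityMeasure π' ∧ π' ≪ π ∧ π'.map e = κ := by
  have hmap : (π.withDensity (fun y => κ.rnDeriv (π.map e) (e y))).map e = κ := by
    ext s hs
    rw [Measure.map_apply he hs, withDensity_apply _ (he hs),
      ← setLIntegral_map hs (Measure.measurable_rnDeriv _ _) he, Measure.setLIntegral_rnDeriv h]
  refine ⟨_, ⟨?_⟩, withDensity_absolutelyContinuous _ _, hmap⟩
  have := congrArg (fun ν => ν univ) hmap
  simp only [Measure.map_apply he MeasurableSet.univ, preimage_univ, measure_univ] at this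
  exact this

lemma overlap {Z : Type*} [MeasurableSpace Z] (μ ν : Measure Z) [IsFiniteMeasure μ]
    [SigmaFinite ν] (h : ¬ μ ⟂ₘ ν) : ∃ κ : Measure Z, IsProbabilityMeasure κ ∧ κ ≪ μ ∧ κ ≪ ν := by
  set κ₀ := ν.withDensity (μ.rnDeriv ν)
  have hle : κ₀ ≤ μ := Measure.withDensity_rnDeriv_le μ ν
  haveI : IsFiniteMeasure κ₀ := isFiniteMeasure_of_le μ hle
  have hne : κ₀ ≠ 0 := by
    intro h0
    rw [withDensity_eq_zero_iff (Measure.measurable_rnDeriv _ _).aemeasurable] at h0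
    exact h ((Measure.rnDeriv_eq_zero _ _).1 h0)
  haveI : NeZero κ₀ := ⟨hne⟩
  have hsm : (κ₀ univ)⁻¹ • κ₀ ≪ κ₀ := Measure.smul_absolutelyContinuous
  exact ⟨(κ₀ univ)⁻¹ • κ₀, inferInstance, hsm.trans hle.absolutelyContinuous,
    hsm.trans (withDensity_absolutelyContinuous _ _)⟩

lemma geo_dist_le (γ : Geo X) (a b : unitInterval) :
    dist (eval a γ) (eval b γ) ≤ dist (eval 0 γ) (eval 1 γ) := by
  rw [geo_dist γ a b]
  have : |(a : ℝ) - b| ≤ 1 := by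
    rw [abs_le]; constructor <;> linarith [a.2.1, a.2.2, b.2.1, b.2.2]
  nlinarith [dist_nonneg (x := eval 0 γ) (y := eval 1 γ)]

lemma map_restr [BorelSpace X] (π : Measure (Geo X)) (a b u : unitInterval) :
    (π.map (restrGeo a b)).map (eval u) = π.map (eval (restrPt a b u)) := by
  rw [Measure.map_map (measurable_geval u) (measurable_restrGeo a b)]
  rfl

lemma prob_map [BorelSpace X] (π : Measure (Geo X)) [IsProbabilityMeasure π] (t : unitInterval) :
    IsProbabilityMeasure (π.map (eval t)) :=
  Measure.isProbabilityMeasure_map (measurable_geval t).aemeasurable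

lemma dist_restr [BorelSpace X] {π : Measure (Geo X)} {D : ℝ}
    (hD : ∀ᵐ γ ∂π, dist (eval 0 γ) (eval 1 γ) ≤ D) (a b : unitInterval) :
    ∀ᵐ γ ∂(π.map (restrGeo a b)), dist (eval 0 γ) (eval 1 γ) ≤ D := by
  refine (ae_map_iff (measurable_restrGeo a b).aemeasurable ?_).2 ?_
  · exact measurableSet_le ((continuous_geval 0).dist (continuous_geval 1)).measurable
      measurable_const
  · filter_upwards [hD] with γ hγ
    exact (geo_dist_le γ _ _).trans hγ

lemma UF_fwd [BorelSpace X] {m : Measure X} [SigmaFinite m] {K N C D : ℝ} (hN : 1 ≤ N)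
    (hCD : IsCDStar K N m) (hGT : GoodTransport m)
    (hC : ∀ θ : ℝ, 0 ≤ θ → θ ≤ D → ∀ τ : ℝ, 0 ≤ τ → τ ≤ 1 →
      ENNReal.ofReal (1 - τ * C) ≤ sigmaCoeff K (N + 1) (1 - τ) θ)
    {π : Measure (Geo X)} [IsProbabilityMeasure π] (h : Good π)
    (hD : ∀ᵐ γ ∂π, dist (eval 0 γ) (eval 1 γ) ≤ D)
    (h0 : π.map (eval 0) ≪ m) (h1 : π.map (eval 1) ≪ m) {t t' : unitInterval}
    (htt : (t : ℝ) ≤ t') (ht : (t : ℝ) < 1) :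
    ENNReal.ofReal (1 - (t' - t) / (1 - t) * C) * UF (1 - 1 / (N + 1)) m (π.map (eval t)) ≤
      UF (1 - 1 / (N + 1)) m (π.map (eval t')) := by
  have ht1 : (0 : ℝ) < 1 - t := by linarith
  have ht' := t'.2.2
  set u : unitInterval := ⟨(t' - t) / (1 - t), div_nonneg (by linarith) ht1.le,
    (div_le_one ht1).2 (by linarith)⟩ with hu
  have hr : restrPt t 1 u = t' := by
    apply Subtype.ext
    simp only [restrPt, hu, Set.Icc.coe_one]
    field_simp
    ring
  haveI : IsProbabilityMeasure (π.map (restrGeo t 1)) :=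
    Measure.isProbabilityMeasure_map (measurable_restrGeo t 1).aemeasurable
  have k0 : (π.map (restrGeo t 1)).map (eval 0) = π.map (eval t) := by
    rw [map_restr, restrPt_zero]
  have k1 : (π.map (restrGeo t 1)).map (eval 1) = π.map (eval 1) := by
    rw [map_restr, restrPt_one]
  have ku : (π.map (restrGeo t 1)).map (eval u) = π.map (eval t') := by
    rw [map_restr, hr]
  have a0 : (π.map (restrGeo t 1)).map (eval 0) ≪ m := k0 ▸ ac_mid hN hCD hGT h h0 h1 t
  have := UF_left (by linarith) hC (dist_restr hD t 1) a0
    (cd_of_good hCD hGT (h.restr_right t) a0 (k1 ▸ h1) u (N + 1) (by linarith))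
  rwa [k0, ku] at this

lemma UF_bwd [BorelSpace X] {m : Measure X} [SigmaFinite m] {K N C D : ℝ} (hN : 1 ≤ N)
    (hCD : IsCDStar K N m) (hGT : GoodTransport m)
    (hC : ∀ θ : ℝ, 0 ≤ θ → θ ≤ D → ∀ τ : ℝ, 0 ≤ τ → τ ≤ 1 →
      ENNReal.ofReal (1 - τ * C) ≤ sigmaCoeff K (N + 1) (1 - τ) θ)
    {π : Measure (Geo X)} [IsProbabilityMeasure π] (h : Good π)
    (hD : ∀ᵐ γ ∂π, dist (eval 0 γ) (eval 1 γ) ≤ D)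
    (h0 : π.map (eval 0) ≪ m) (h1 : π.map (eval 1) ≪ m) {t t' : unitInterval}
    (htt : (t : ℝ) ≤ t') (ht : (0 : ℝ) < t') :
    ENNReal.ofReal (1 - (t' - t) / t' * C) * UF (1 - 1 / (N + 1)) m (π.map (eval t')) ≤
      UF (1 - 1 / (N + 1)) m (π.map (eval t)) := by
  set u : unitInterval := ⟨t / t', div_nonneg t.2.1 ht.le, (div_le_one ht).2 (by linarith)⟩ with hu
  have hr : restrPt 0 t' u = t := by
    apply Subtype.ext
    simp only [restrPt, hu, Set.Icc.coe_zero]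
    field_simp
    ring
  haveI : IsProbabilityMeasure (π.map (restrGeo 0 t')) :=
    Measure.isProbabilityMeasure_map (measurable_restrGeo 0 t').aemeasurable
  have k0 : (π.map (restrGeo 0 t')).map (eval 0) = π.map (eval 0) := by
    rw [map_restr, restrPt_zero]
  have k1 : (π.map (restrGeo 0 t')).map (eval 1) = π.map (eval t') := by
    rw [map_restr, restrPt_one]
  have ku : (π.map (restrGeo 0 t')).map (eval u) = π.map (eval t) := by
    rw [map_restr, hr]
  have a1 : (π.map (restrGeo 0 t')).map (eval 1) ≪ m := k1 ▸ ac_mid hN hCD hGT h h0 h1 t'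
  have := UF_right (by linarith) hC (dist_restr hD 0 t') a1
    (cd_of_good hCD hGT (h.restr_left t') (k0 ▸ h0) a1 u (N + 1) (by linarith))
  rw [k1, ku] at this
  have e : (t' - t : ℝ) / t' = 1 - (u : ℝ) := by
    simp only [hu]; field_simp
  rwa [e]

lemma Good.mid {π : Measure (Geo X)} (h : Good π) :
    ∃ s : Set X, IsClosed s ∧ Bornology.IsBounded s ∧ ∀ᵐ γ ∂π, ∀ t, eval t γ ∈ s := by
  obtain ⟨D, hD0, hD⟩ := h.dist_le
  obtain ⟨P, Q, f, g, M, hd, hG⟩ := h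
  refine ⟨cthickening D P, isClosed_cthickening, (hd.bdd.subset subset_union_left).cthickening, ?_⟩
  filter_upwards [hD, hG] with γ h1 h2 t
  exact mem_cthickening_of_dist_le _ _ _ _ h2.1 ((geo_dist_le γ t 0).trans h1)

lemma Good.UF_ne_top [BorelSpace X] {m : Measure X} [SigmaFinite m]
    (hm_bdd : ∀ s : Set X, Bornology.IsBounded s → m s ≠ ⊤) {N : ℝ} (hN : 1 ≤ N)
    {π : Measure (Geo X)} [IsProbabilityMeasure π] (h : Good π) {t : unitInterval}
    (ht : π.map (eval t) ≪ m) : UF (1 - 1 / (N + 1)) m (π.map (eval t)) ≠ ⊤ := by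
  obtain ⟨s, hs, hb, hG⟩ := h.mid
  haveI := prob_map π t
  have hz : (π.map (eval t)) sᶜ = 0 := by
    refine (ae_map_iff (measurable_geval t).aemeasurable hs.measurableSet).2 ?_
    exact hG.mono fun γ hγ => hγ t
  refine ne_top_of_le_ne_top ?_ (UF_le ht (by linarith) hs.measurableSet hz)
  exact ENNReal.rpow_ne_top_of_nonneg (by positivity) (hm_bdd s hb)

instance mix_prob {Y : Type*} [MeasurableSpace Y] (a b : Measure Y) [IsProbabilityMeasure a]
    [IsProbabilityMeasure b] : IsProbabilityMeasure ((2⁻¹ : ℝ≥0∞) • (a + b)) := by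
  constructor
  simp only [Measure.smul_apply, Measure.add_apply, measure_univ, smul_eq_mul]
  rw [one_add_one_eq_two]
  exact ENNReal.inv_mul_cancel (by simp) (by simp)

lemma mix_map [BorelSpace X] (a b : Measure (Geo X)) (t : unitInterval) :
    ((2⁻¹ : ℝ≥0∞) • (a + b)).map (eval t) = (2⁻¹ : ℝ≥0∞) • (a.map (eval t) + b.map (eval t)) := by
  rw [Measure.map_smul, Measure.map_add _ _ (measurable_geval t)]

lemma mix_self {Y : Type*} [MeasurableSpace Y] (a : Measure Y) : (2⁻¹ : ℝ≥0∞) • (a + a) = a := by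
  rw [← two_smul ℝ≥0∞ a, smul_smul, ENNReal.inv_mul_cancel (by simp) (by simp), one_smul]

lemma mix_ac {Y : Type*} [MeasurableSpace Y] {a b c : Measure Y} (ha : a ≪ c) (hb : b ≪ c) :
    (2⁻¹ : ℝ≥0∞) • (a + b) ≪ c := by
  refine Measure.AbsolutelyContinuous.trans Measure.smul_absolutelyContinuous ?_
  intro s hs
  rw [Measure.add_apply, ha hs, hb hs, add_zero]

lemma stepB [BorelSpace X] {m : Measure X} [SigmaFinite m]
    (hm_bdd : ∀ s : Set X, Bornology.IsBounded s → m s ≠ ⊤) {K N C D : ℝ} (hN : 1 ≤ N)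
    (hCD : IsCDStar K N m) (hGT : GoodTransport m)
    (hC : ∀ θ : ℝ, 0 ≤ θ → θ ≤ D → ∀ τ : ℝ, 0 ≤ τ → τ ≤ 1 →
      ENNReal.ofReal (1 - τ * C) ≤ sigmaCoeff K (N + 1) (1 - τ) θ)
    {a b : Measure (Geo X)} [IsProbabilityMeasure a] [IsProbabilityMeasure b] (h : Good (a + b))
    (hD : ∀ᵐ γ ∂(a + b), dist (eval 0 γ) (eval 1 γ) ≤ D)
    (ha0 : a.map (eval 0) ≪ m) (ha1 : a.map (eval 1) ≪ m)
    (hb0 : b.map (eval 0) ≪ m) (hb1 : b.map (eval 1) ≪ m) {t t' : unitInterval}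
    (htt : (t : ℝ) ≤ t') (ht : (t : ℝ) < 1) (ht' : (0 : ℝ) < t') {q : ℝ}
    (hq1 : q ≤ 1 - (t' - t) / (1 - t) * C) (hq2 : q ≤ 1 - (t' - t) / t' * C)
    (hq : 1 < ENNReal.ofReal q *
      ((2⁻¹ : ℝ≥0∞) ^ (1 - 1 / (N + 1)) * (ENNReal.ofReal q + ENNReal.ofReal q)))
    (hab : a.map (eval t) = b.map (eval t)) : ¬ a.map (eval t') ⟂ₘ b.map (eval t') := by
  intro hsing
  set p := 1 - 1 / (N + 1) with hp
  have hp0 : 0 < p := by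
    rw [hp, sub_pos, div_lt_one (by linarith)]; linarith
  have aab : a ≪ a + b := Measure.absolutelyContinuous_of_le (Measure.le_add_right le_rfl)
  have bab : b ≪ a + b := Measure.absolutelyContinuous_of_le (Measure.le_add_left le_rfl)
  have ga : Good a := h.mono aab
  have gb : Good b := h.mono bab
  have hmac : (2⁻¹ : ℝ≥0∞) • (a + b) ≪ a + b := Measure.smul_absolutelyContinuous
  haveI := prob_map a t
  haveI := prob_map a t'
  haveI := prob_map b t'
  have act := ac_mid hN hCD hGT ga ha0 ha1 t
  have f1 := UF_fwd hN hCD hGT hC ga (aab.ae_le hD) ha0 ha1 htt ht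
  have f2 := UF_fwd hN hCD hGT hC gb (bab.ae_le hD) hb0 hb1 htt ht
  have f3 := UF_bwd hN hCD hGT hC (h.mono hmac) (hmac.ae_le hD)
    (by rw [mix_map]; exact mix_ac ha0 hb0) (by rw [mix_map]; exact mix_ac ha1 hb1) htt ht'
  rw [mix_map, mix_map, ← hab, mix_self, UF_mix (ac_mid hN hCD hGT ga ha0 ha1 t')
    (ac_mid hN hCD hGT gb hb0 hb1 t') hsing hp0] at f3
  rw [← hab] at f2
  set U := UF p m (a.map (eval t))
  have hU0 : U ≠ 0 := UF_ne_zero act hp0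
  have hUt : U ≠ ⊤ := ga.UF_ne_top hm_bdd hN act
  have g1 := (mul_le_mul_left (ENNReal.ofReal_le_ofReal hq1) U).trans f1
  have g2 := (mul_le_mul_left (ENNReal.ofReal_le_ofReal hq1) U).trans f2
  have g3 := (mul_le_mul_left (ENNReal.ofReal_le_ofReal hq2) _).trans f3
  have g4 : (ENNReal.ofReal q *
      ((2⁻¹ : ℝ≥0∞) ^ p * (ENNReal.ofReal q + ENNReal.ofReal q))) * U ≤ U := by
    refine le_trans ?_ g3
    rw [mul_assoc, mul_assoc, add_mul]
    gcongr
  have g5 : 1 * U < (ENNReal.ofReal q *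
      ((2⁻¹ : ℝ≥0∞) ^ p * (ENNReal.ofReal q + ENNReal.ofReal q))) * U :=
    (ENNReal.mul_lt_mul_iff_left hU0 hUt).2 hq
  rw [one_mul] at g5
  exact absurd g4 (not_le.2 g5)

lemma exists_q {N : ℝ} (hN : 1 ≤ N) : ∃ q : ℝ, 0 < q ∧ q < 1 ∧ 1 < ENNReal.ofReal q *
      ((2⁻¹ : ℝ≥0∞) ^ (1 - 1 / (N + 1)) * (ENNReal.ofReal q + ENNReal.ofReal q)) := by
  have hn : 0 < 1 / (N + 1) := by positivity
  refine ⟨(2 : ℝ) ^ (-(1 / (N + 1)) / 4), by positivity,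
    Real.rpow_lt_one_of_one_lt_of_neg (by norm_num) (by linarith), ?_⟩
  have h2 : ENNReal.ofReal ((2 : ℝ) ^ (-(1 / (N + 1)) / 4)) = (2 : ℝ≥0∞) ^ (-(1 / (N + 1)) / 4) := by
    rw [← ENNReal.ofReal_rpow_of_pos (by norm_num)]; simp
  rw [h2, ← two_mul, ENNReal.inv_rpow, ← ENNReal.rpow_neg]
  have e : (2 : ℝ≥0∞) * (2 : ℝ≥0∞) ^ (-(1 / (N + 1)) / 4)
      = (2 : ℝ≥0∞) ^ (1 + -(1 / (N + 1)) / 4) := by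
    rw [ENNReal.rpow_add _ _ (by simp) (by simp), ENNReal.rpow_one]
  rw [e, ← ENNReal.rpow_add _ _ (by simp) (by simp), ← ENNReal.rpow_add _ _ (by simp) (by simp)]
  exact ENNReal.one_lt_rpow (by norm_num) (by linarith)

lemma UF_cond [BorelSpace X] {m : Measure X} [SigmaFinite m] {F : Set X} (hF : MeasurableSet F)
    (h0 : m F ≠ 0) (ht : m F ≠ ⊤) {r : ℝ} (hr : 0 < 1 - r) :
    UF (1 - r) m (ProbabilityTheory.cond m F) = (m F) ^ r := by
  unfold UF ProbabilityTheory.cond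
  haveI : IsFiniteMeasure (m.restrict F) := ⟨by simpa using ht.lt_top⟩
  have e1 := Measure.rnDeriv_smul_left_of_ne_top (m.restrict F) m (r := (m F)⁻¹)
    (ENNReal.inv_ne_top.2 h0)
  have e2 := Measure.rnDeriv_restrict_self m hF
  have : ∀ᵐ x ∂m, (((m F)⁻¹ • m.restrict F).rnDeriv m x) ^ (1 - r)
      = F.indicator (fun _ => ((m F)⁻¹) ^ (1 - r)) x := by
    filter_upwards [e1, e2] with x h1 h2
    rw [h1, Pi.smul_apply, h2]
    by_cases hx : x ∈ F
    · simp [hx]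
    · simp only [hx, not_false_eq_true, indicator_of_notMem, smul_eq_mul, mul_zero]
      exact ENNReal.zero_rpow_of_pos hr
  rw [lintegral_congr_ae this, lintegral_indicator_const hF, ENNReal.inv_rpow, ← ENNReal.rpow_neg]
  conv_lhs => enter [2]; rw [← ENNReal.rpow_one (m F)]
  rw [← ENNReal.rpow_add _ _ h0 ht]
  congr 1; ring

lemma stepA [BorelSpace X] [ProperSpace X] {m : Measure X} [SigmaFinite m]
    (hm_bdd : ∀ s : Set X, Bornology.IsBounded s → m s ≠ ⊤) {K N C D : ℝ} (hN : 1 ≤ N)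
    (hCD : IsCDStar K N m) (hGT : GoodTransport m)
    (hC : ∀ θ : ℝ, 0 ≤ θ → θ ≤ D → ∀ τ : ℝ, 0 ≤ τ → τ ≤ 1 →
      ENNReal.ofReal (1 - τ * C) ≤ sigmaCoeff K (N + 1) (1 - τ) θ)
    {a b : Measure (Geo X)} [IsProbabilityMeasure a] [IsProbabilityMeasure b] (h : Good (a + b))
    (hD : ∀ᵐ γ ∂(a + b), dist (eval 0 γ) (eval 1 γ) ≤ D) {F : Set X} (hF : IsCompact F)
    (hmF : m F ≠ 0)
    (ha0 : a.map (eval 0) = ProbabilityTheory.cond m F) (ha1 : a.map (eval 1) ≪ m)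
    (hb0 : b.map (eval 0) = ProbabilityTheory.cond m F) (hb1 : b.map (eval 1) ≪ m)
    {c : ℝ} (hc0 : 0 < c) (hc1 : c ≤ 1) : ∃ t : unitInterval, 0 < (t : ℝ) ∧ (t : ℝ) < c ∧
      ¬ a.map (eval t) ⟂ₘ b.map (eval t) := by
  by_contra! hcon
  set r := 1 / (N + 1) with hr
  have hr0 : 0 < r := by rw [hr]; positivity
  have hp0 : 0 < 1 - r := by
    rw [hr, sub_pos, div_lt_one (by linarith)]; linarith
  have hmFt : m F ≠ ⊤ := hm_bdd F hF.isBounded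
  have hFm : MeasurableSet F := hF.measurableSet
  have aab : a ≪ a + b := Measure.absolutelyContinuous_of_le (Measure.le_add_right le_rfl)
  have bab : b ≪ a + b := Measure.absolutelyContinuous_of_le (Measure.le_add_left le_rfl)
  have ga : Good a := h.mono aab
  have gb : Good b := h.mono bab
  have hcm : ProbabilityTheory.cond m F ≪ m := ProbabilityTheory.cond_absolutelyContinuous
  have hmac : (2⁻¹ : ℝ≥0∞) • (a + b) ≪ a + b := Measure.smul_absolutelyContinuous
  have key : ∀ t : unitInterval, 0 < (t : ℝ) → (t : ℝ) < c →
      (2⁻¹ : ℝ≥0∞) ^ (1 - r) * (2 * (ENNReal.ofReal (1 - t * C) * (m F) ^ r))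
        ≤ (m (cthickening (D * t) F)) ^ r := by
    intro t ht0 htc
    haveI := prob_map a t
    haveI := prob_map b t
    have aca := ac_mid hN hCD hGT ga (ha0 ▸ hcm) ha1 t
    have acb := ac_mid hN hCD hGT gb (hb0 ▸ hcm) hb1 t
    have f1 := UF_left (by linarith) hC (aab.ae_le hD) (ha0 ▸ hcm)
      (cd_of_good hCD hGT ga (ha0 ▸ hcm) ha1 t (N + 1) (by linarith))
    have f2 := UF_left (by linarith) hC (bab.ae_le hD) (hb0 ▸ hcm)
      (cd_of_good hCD hGT gb (hb0 ▸ hcm) hb1 t (N + 1) (by linarith))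
    rw [ha0, UF_cond hFm hmF hmFt hp0] at f1
    rw [hb0, UF_cond hFm hmF hmFt hp0] at f2
    have e := UF_mix aca acb (hcon t ht0 htc) hp0
    have hz : ∀ ν : Measure (Geo X), ν ≪ a + b → ν.map (eval 0) = ProbabilityTheory.cond m F →
        (ν.map (eval t)) (cthickening (D * t) F)ᶜ = 0 := by
      intro ν hν hν0
      have hFae : ∀ᵐ γ ∂ν, eval 0 γ ∈ F := by
        refine ae_of_ae_map (measurable_geval 0).aemeasurable (p := fun x => x ∈ F) ?_
        rw [hν0]
        exact ProbabilityTheory.ae_cond_mem hFm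
      refine (ae_map_iff (measurable_geval t).aemeasurable
        isClosed_cthickening.measurableSet).2 ?_
      filter_upwards [hFae, hν.ae_le hD] with γ h1 h2
      refine mem_cthickening_of_dist_le _ _ _ _ h1 ?_
      rw [geo_dist γ t 0]
      simp only [Set.Icc.coe_zero, sub_zero, abs_of_nonneg t.2.1]
      nlinarith
    have hz' : ((2⁻¹ : ℝ≥0∞) • (a.map (eval t) + b.map (eval t))) (cthickening (D * t) F)ᶜ = 0 := by
      rw [Measure.smul_apply, Measure.add_apply, hz a aab ha0, hz b bab hb0]; simp
    have f3 := UF_le (mix_ac aca acb) (N' := N + 1) (by linarith)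
      isClosed_cthickening.measurableSet hz'
    refine le_trans ?_ f3
    rw [e, two_mul]
    gcongr
  -- the limit
  haveI : IsFiniteMeasureOnCompacts m := ⟨fun k hk => (hm_bdd k hk.isBounded).lt_top⟩
  have hlim1 : Filter.Tendsto (fun t : ℝ => (m (cthickening (D * t) F)) ^ r) (nhdsWithin 0 (Ioi 0))
      (nhds ((m F) ^ r)) := by
    refine Filter.Tendsto.ennrpow_const _ ?_
    refine (tendsto_measure_cthickening_of_isCompact hF).comp ?_
    have : Continuous (fun t : ℝ => D * t) := by fun_prop
    have := this.tendsto 0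
    rw [mul_zero] at this
    exact this.mono_left nhdsWithin_le_nhds
  have hfin : (m F) ^ r ≠ ⊤ := ENNReal.rpow_ne_top_of_nonneg hr0.le hmFt
  have hne0 : (m F) ^ r ≠ 0 := by
    rw [Ne, ENNReal.rpow_eq_zero_iff_of_pos hr0]; exact hmF
  have hlim2 : Filter.Tendsto (fun t : ℝ => (2⁻¹ : ℝ≥0∞) ^ (1 - r) *
      (2 * (ENNReal.ofReal (1 - t * C) * (m F) ^ r))) (nhdsWithin 0 (Ioi 0))
      (nhds ((2⁻¹ : ℝ≥0∞) ^ (1 - r) * (2 * (1 * (m F) ^ r)))) := by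
    refine ENNReal.Tendsto.const_mul (ENNReal.Tendsto.const_mul (ENNReal.Tendsto.mul_const ?_
      (Or.inr hfin)) (Or.inr (by simp))) (Or.inr ?_)
    · have : Continuous (fun t : ℝ => ENNReal.ofReal (1 - t * C)) :=
        ENNReal.continuous_ofReal.comp (by fun_prop)
      have := this.tendsto 0
      simp only [zero_mul, sub_zero, ENNReal.ofReal_one] at this
      exact this.mono_left nhdsWithin_le_nhds
    · exact ENNReal.rpow_ne_top_of_nonneg hp0.le (by simp)
  have hle := le_of_tendsto_of_tendsto hlim2 hlim1 (by
    filter_upwards [Ioo_mem_nhdsGT hc0] with t ht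
    exact key ⟨t, ht.1.le, ht.2.le.trans hc1⟩ ht.1 ht.2)
  rw [one_mul, ← mul_assoc] at hle
  have h2 : 1 < (2⁻¹ : ℝ≥0∞) ^ (1 - r) * 2 := by
    rw [ENNReal.inv_rpow, ← ENNReal.rpow_neg]
    conv_rhs => enter [2]; rw [← ENNReal.rpow_one 2]
    rw [← ENNReal.rpow_add _ _ (by simp) (by simp)]
    exact ENNReal.one_lt_rpow (by norm_num) (by linarith)
  have g5 := (ENNReal.mul_lt_mul_iff_left hne0 hfin).2 h2
  rw [one_mul] at g5
  exact absurd hle (not_le.2 g5)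

lemma ac_add {Y : Type*} [MeasurableSpace Y] {a b c d : Measure Y} (h1 : a ≪ c) (h2 : b ≪ d) :
    a + b ≪ c + d := by
  intro s hs
  rw [Measure.add_apply, add_eq_zero] at hs
  rw [Measure.add_apply, h1 hs.1, h2 hs.2, add_zero]

lemma main_contra [BorelSpace X] [ProperSpace X] {m : Measure X} [SigmaFinite m]
    (hm_bdd : ∀ s : Set X, Bornology.IsBounded s → m s ≠ ⊤) {K N : ℝ} (hN : 1 ≤ N)
    (hCD : IsCDStar K N m) (hGT : GoodTransport m)
    {π₁ π₂ : Measure (Geo X)} [IsProbabilityMeasure π₁] [IsProbabilityMeasure π₂]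
    (h : Good (π₁ + π₂)) {F : Set X} (hF : IsCompact F) (hmF : m F ≠ 0)
    (ha0 : π₁.map (eval 0) = ProbabilityTheory.cond m F) (ha1 : π₁.map (eval 1) ≪ m)
    (hb0 : π₂.map (eval 0) = ProbabilityTheory.cond m F) (hb1 : π₂.map (eval 1) ≪ m)
    {c : unitInterval} (hc0 : 0 < (c : ℝ)) (hc1 : (c : ℝ) < 1) {V₁ V₂ : Set X}
    (hV1 : ∀ᵐ γ ∂π₁, eval c γ ∈ V₁) (hV2 : ∀ᵐ γ ∂π₂, eval c γ ∈ V₂)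
    (mV1 : MeasurableSet V₁) (mV2 : MeasurableSet V₂) (hdisj : Disjoint V₁ V₂) : False := by
  obtain ⟨D, hD0, hD⟩ := h.dist_le
  obtain ⟨C, hC1, hC⟩ := sig_lower K (N + 1) D (by linarith)
  obtain ⟨ε, hε0, hεc, hε⟩ := stepA hm_bdd hN hCD hGT hC h hD hF hmF ha0 ha1 hb0 hb1 hc0 hc1.le
  obtain ⟨q, hq0, hq1, hq⟩ := exists_q hN
  have hcm : ProbabilityTheory.cond m F ≪ m := ProbabilityTheory.cond_absolutelyContinuous
  have ha0' : π₁.map (eval 0) ≪ m := ha0 ▸ hcm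
  have hb0' : π₂.map (eval 0) ≪ m := hb0 ▸ hcm
  let Pr : unitInterval → Prop := fun t => ∃ a b : Measure (Geo X), IsProbabilityMeasure a ∧
    IsProbabilityMeasure b ∧ a ≪ π₁ ∧ b ≪ π₂ ∧ a.map (eval t) = b.map (eval t)
  have hPr : ∀ (a b : Measure (Geo X)) (t : unitInterval), IsProbabilityMeasure a →
      IsProbabilityMeasure b → a ≪ π₁ → b ≪ π₂ → ¬ a.map (eval t) ⟂ₘ b.map (eval t) → Pr t := by
    intro a b t ia ib ha hb hs
    haveI := prob_map a t
    haveI := prob_map b t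
    obtain ⟨κ, iκ, h1, h2⟩ := overlap _ _ hs
    obtain ⟨a', ia', ha', e1⟩ := reweight a (measurable_geval t) κ h1
    obtain ⟨b', ib', hb', e2⟩ := reweight b (measurable_geval t) κ h2
    exact ⟨a', b', ia', ib', ha'.trans ha, hb'.trans hb, e1.trans e2.symm⟩
  have hbase : Pr ε := hPr π₁ π₂ ε inferInstance inferInstance (fun _ h => h) (fun _ h => h) hε
  have hmin : 0 < min (ε : ℝ) (1 - c) := lt_min hε0 (by linarith)
  set s : ℝ := (1 - q) / C * min (ε : ℝ) (1 - c) with hs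
  have hC0 : 0 < C := by linarith
  have hs0 : 0 < s := mul_pos (div_pos (by linarith) hC0) hmin
  have hstep : ∀ t t' : unitInterval, (ε : ℝ) ≤ t → (t : ℝ) ≤ t' → (t' : ℝ) ≤ c →
      (t' : ℝ) - t ≤ s → Pr t → Pr t' := by
    rintro t t' h1 h2 h3 h4 ⟨a, b, ia, ib, ha, hb, hab⟩
    have hac := ac_add ha hb
    have hk : ∀ x : ℝ, min (ε : ℝ) (1 - c) ≤ x → q ≤ 1 - (t' - t) / x * C := by
      intro x hx
      have hx0 : 0 < x := hmin.trans_le hx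
      have : (t' - t) / x ≤ (1 - q) / C := by
        rw [div_le_iff₀ hx0]
        refine h4.trans ?_
        rw [hs]
        exact mul_le_mul_of_nonneg_left hx (div_nonneg (by linarith) hC0.le)
      rw [le_div_iff₀ hC0] at this
      linarith
    refine hPr a b t' ia ib ha hb ?_
    refine stepB hm_bdd hN hCD hGT hC (h.mono hac) (hac.ae_le hD)
      ((ha.map (measurable_geval 0)).trans ha0') ((ha.map (measurable_geval 1)).trans ha1)
      ((hb.map (measurable_geval 0)).trans hb0') ((hb.map (measurable_geval 1)).trans hb1)
      h2 (by linarith) (by linarith) (hk _ ?_) (hk _ ?_) hq hab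
    · exact (min_le_right _ _).trans (by linarith)
    · exact (min_le_left _ _).trans (by linarith)
  have hmem : ∀ k : ℕ, min ((ε : ℝ) + k * s) c ∈ unitInterval := fun k =>
    ⟨le_min (by positivity) hc0.le, (min_le_right _ _).trans hc1.le⟩
  have hind : ∀ k : ℕ, Pr ⟨min ((ε : ℝ) + k * s) c, hmem k⟩ := by
    intro k
    induction k with
    | zero =>
      have : (⟨min ((ε : ℝ) + ((0 : ℕ) : ℝ) * s) c, hmem 0⟩ : unitInterval) = ε := by
        apply Subtype.ext
        simp [hεc.le]
      rw [this]; exact hbase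
    | succ k ih =>
      refine hstep _ _ ?_ ?_ ?_ ?_ ih
      · exact le_min (le_add_of_nonneg_right (by positivity)) hεc.le
      · refine min_le_min_right _ ?_
        push_cast
        nlinarith
      · exact min_le_right _ _
      · show min ((ε : ℝ) + ((k + 1 : ℕ) : ℝ) * s) c - min ((ε : ℝ) + k * s) c ≤ s
        push_cast
        rcases le_total ((ε : ℝ) + k * s) c with h' | h'
        · rw [min_eq_left h']
          have := min_le_left ((ε : ℝ) + (k + 1) * s) c
          linarith
        · rw [min_eq_right h']
          have := min_le_right ((ε : ℝ) + (k + 1) * s) c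
          linarith
  obtain ⟨k, hk⟩ := exists_nat_gt ((c : ℝ) / s)
  rw [div_lt_iff₀ hs0] at hk
  obtain ⟨a, b, ia, ib, ha, hb, hab⟩ := hind k
  have : (⟨min ((ε : ℝ) + k * s) c, hmem k⟩ : unitInterval) = c := by
    apply Subtype.ext
    exact min_eq_right (by linarith)
  rw [this] at hab
  have k1 : ∀ᵐ x ∂(a.map (eval c)), x ∈ V₁ :=
    (ae_map_iff (measurable_geval c).aemeasurable mV1).2 (ha.ae_le hV1)
  have k2 : ∀ᵐ x ∂(a.map (eval c)), x ∈ V₂ := by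
    rw [hab]
    exact (ae_map_iff (measurable_geval c).aemeasurable mV2).2 (hb.ae_le hV2)
  haveI := prob_map a c
  obtain ⟨x, hx1, hx2⟩ := (k1.and k2).exists
  exact hdisj.le_bot ⟨hx1, hx2⟩

lemma section_of_compact [BorelSpace X] {Z : Set (Geo X)} (hZ : IsCompact Z) (hne : Z.Nonempty) :
    ∃ T : X → Geo X, Measurable T ∧ ∀ x ∈ eval 0 '' Z, T x ∈ Z ∧ eval 0 (T x) = x := by
  haveI : CompactSpace Z := isCompact_iff_compactSpace.1 hZ
  haveI : Nonempty Z := hne.to_subtype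
  obtain ⟨g, hg, hgs⟩ := exists_borel_section (fun γ : Z => eval 0 (γ : Geo X))
    ((continuous_geval 0).comp continuous_subtype_val)
  refine ⟨fun x => (g x : Geo X), measurable_subtype_coe.comp hg, ?_⟩
  rintro x ⟨γ, hγ, rfl⟩
  exact ⟨(g _).2, hgs _ ⟨⟨γ, hγ⟩, rfl⟩⟩

lemma lemmaH [BorelSpace X] {m : Measure X} [SigmaFinite m] {K N : ℝ} (hN : 1 ≤ N)
    (hCD : IsCDStar K N m) {P Q : Set X} {f g : X → ℝ} {M : ℝ} (hd : DualPair P Q f g M)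
    {E : Set X} (hE : MeasurableSet E) (h0 : m E ≠ 0) (ht : m E ≠ ⊤) {T : X → Geo X}
    (hT : Measurable T) (hTE : ∀ x ∈ E, T x ∈ GSet P Q f g ∧ eval 0 (T x) = x)
    {t : unitInterval} (ht1 : (t : ℝ) < 1) :
    ∃ π : Measure (Geo X), IsProbabilityMeasure π ∧ π.map (eval 0) ≪ m.restrict E ∧
      π.map (eval t) ≪ m ∧ ∀ᵐ γ ∂π, γ ∈ GSet P Q f g := by
  set μ := ProbabilityTheory.cond m E with hμ
  haveI iμ : IsProbabilityMeasure μ := ProbabilityTheory.cond_isProbabilityMeasure_of_finite h0 ht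
  have hμE : ∀ᵐ x ∂μ, x ∈ E := ProbabilityTheory.ae_cond_mem hE
  have hμr : μ ≪ m.restrict E := Measure.smul_absolutelyContinuous
  have hμm : μ ≪ m := ProbabilityTheory.cond_absolutelyContinuous
  haveI : IsProbabilityMeasure (μ.map T) := Measure.isProbabilityMeasure_map hT.aemeasurable
  have e0 : (μ.map T).map (eval 0) = μ := by
    rw [Measure.map_map (measurable_geval 0) hT]
    conv_rhs => rw [← Measure.map_id (μ := μ)]
    refine Measure.map_congr ?_
    filter_upwards [hμE] with x hx
    exact (hTE x hx).2
  have hG : ∀ᵐ γ ∂(μ.map T), γ ∈ GSet P Q f g := by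
    refine (ae_map_iff hT.aemeasurable (measurableSet_GSet hd)).2 ?_
    exact hμE.mono fun x hx => (hTE x hx).1
  have hgood : Good (μ.map T) := ⟨_, _, _, _, _, hd, hG⟩
  obtain ⟨s, hsm, hsb, hs0, hs1⟩ := hgood.ends
  obtain ⟨π, hopt, hineq⟩ := hCD ((μ.map T).map (eval 0)) ((μ.map T).map (eval 1))
    (prob_map _ 0) (prob_map _ 1) ⟨s, hsb, hs0, hs1⟩
  haveI := hopt.1
  have hGπ := GSet_of_opt hd hG hopt
  have p0 : π.map (eval 0) = μ := hopt.2.1.trans e0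
  have hne := rnDeriv_ne_zero_of_cd (K := K) (N' := N + 1) (by linarith) (p0 ▸ hμm) t ht1
    (hineq t (N + 1) (by linarith))
  haveI := prob_map π t
  rw [Measure.rnDeriv_eq_zero] at hne
  obtain ⟨κ, iκ, h1, h2⟩ := overlap _ _ hne
  obtain ⟨π', i', hac, hmap⟩ := reweight π (measurable_geval t) κ h1
  refine ⟨π', i', ?_, hmap ▸ h2, hac.ae_le hGπ⟩
  refine (hac.map (measurable_geval 0)).trans ?_
  rw [p0]
  exact hμr

lemma density_set [BorelSpace X] {m μ : Measure X} [SigmaFinite m] [IsProbabilityMeasure μ]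
    {E : Set X} (hE : MeasurableSet E) (h : μ ≪ m.restrict E) :
    ∃ E' ⊆ E, MeasurableSet E' ∧ m E' ≠ 0 ∧ m.restrict E' ≪ μ := by
  have hm : μ ≪ m := h.trans Measure.restrict_le_self.absolutelyContinuous
  have mρ : Measurable (μ.rnDeriv m) := Measure.measurable_rnDeriv _ _
  have hS : MeasurableSet {x | μ.rnDeriv m x = 0} := mρ (measurableSet_singleton 0)
  have hz : ∀ s, MeasurableSet s → μ s = 0 → ∀ᵐ x ∂m, x ∈ s → μ.rnDeriv m x = 0 := by
    intro s hs h0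
    have : ∫⁻ x in s, μ.rnDeriv m x ∂m = 0 := by
      rw [Measure.setLIntegral_rnDeriv hm, h0]
    rw [lintegral_eq_zero_iff mρ] at this
    exact (ae_restrict_iff' hs).1 this
  refine ⟨E \ {x | μ.rnDeriv m x = 0}, sdiff_subset, hE.diff hS, ?_, ?_⟩
  · intro h0
    have h1 : μ (E \ {x | μ.rnDeriv m x = 0}) = 0 := hm h0
    have h2 : μ Eᶜ = 0 := h (by rw [Measure.restrict_apply hE.compl]; simp)
    have h3 : μ {x | μ.rnDeriv m x = 0} = 0 := by
      rw [← Measure.setLIntegral_rnDeriv hm, setLIntegral_congr_fun (g := fun _ => 0) hS]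
      · simp
      · intro x hx; exact hx
    have h4 : μ univ ≤ 0 := by
      calc μ univ ≤ μ ((E \ {x | μ.rnDeriv m x = 0}) ∪ (Eᶜ ∪ {x | μ.rnDeriv m x = 0})) := by
            refine measure_mono fun x _ => ?_
            by_cases hx : x ∈ E
            · by_cases hx2 : μ.rnDeriv m x = 0
              · exact Or.inr (Or.inr hx2)
              · exact Or.inl ⟨hx, hx2⟩
            · exact Or.inr (Or.inl hx)
        _ ≤ 0 := by
            refine (measure_union_le _ _).trans ?_
            rw [h1, zero_add]
            refine (measure_union_le _ _).trans ?_
            rw [h2, h3, zero_add]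
    rw [measure_univ] at h4
    exact absurd h4 (by simp)
  · refine Measure.AbsolutelyContinuous.mk fun s hs h0 => ?_
    rw [Measure.restrict_apply hs]
    have := hz s hs h0
    refine measure_mono_null ?_ this
    intro x hx
    simp only [mem_compl_iff, mem_ofPred_eq, Classical.not_imp]
    exact ⟨hx.1, hx.2.2⟩

def SRel (P : Set X) (f : X → ℝ) (x y : X) : Prop :=
  x ∈ P ∧ ∀ x' ∈ P, f x' - dist x' y ^ 2 ≤ f x - dist x y ^ 2

lemma SRel.cinf {P : Set X} {f : X → ℝ} {M : ℝ} (hf : ∀ x ∈ P, |f x| ≤ M) {x y : X}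
    (h : SRel P f x y) : f x + cinf P f y = dist x y ^ 2 := by
  refine le_antisymm ?_ ?_
  · linarith [cinf_le hf h.1 y]
  · have : dist x y ^ 2 - f x ≤ _root_.cinf P f y := le_cinf ⟨x, h.1⟩ fun x' hx' => by
      linarith [h.2 x' hx']
    linarith

lemma pair_null [BorelSpace X] [ProperSpace X] (hX : IsGeodesicSpace X) {m : Measure X}
    [SigmaFinite m]
    (hm_bdd : ∀ s : Set X, Bornology.IsBounded s → m s ≠ ⊤) {K N : ℝ} (hN : 1 ≤ N)
    (hCD : IsCDStar K N m) (hGT : GoodTransport m) {P : Set X} (hP : IsCompact P) {f : X → ℝ}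
    (mf : Measurable f) {M : ℝ} (hf : ∀ x ∈ P, |f x| ≤ M)
    (hcl : IsClosed {p : X × ℝ | p.1 ∈ P ∧ p.2 ≤ f p.1}) (p q : X) (r : ℝ)
    (hr : 2 * r < dist p q) :
    m {x | (∃ y ∈ closedBall p r, SRel P f x y) ∧ ∃ y ∈ closedBall q r, SRel P f x y} = 0 := by
  by_contra hne
  set Z : X → Set (Geo X) := fun z =>
    {γ | eval 1 γ ∈ closedBall z r ∧ SRel P f (eval 0 γ) (eval 1 γ)} with hZ
  have hPb := hP.isBounded
  obtain ⟨x₀, hx₀⟩ : P.Nonempty := by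
    obtain ⟨x, hx⟩ := nonempty_of_measure_ne_zero hne
    obtain ⟨⟨y, hy, h⟩, _⟩ := hx
    exact ⟨x, h.1⟩
  have hZcl : ∀ z, IsClosed (Z z) := by
    intro z
    have : Z z = (eval 1 ⁻¹' closedBall z r) ∩ ⋂ x' ∈ P, (fun γ : Geo X => (eval 0 γ,
        f x' - dist x' (eval 1 γ) ^ 2 + dist (eval 0 γ) (eval 1 γ) ^ 2)) ⁻¹'
          {p : X × ℝ | p.1 ∈ P ∧ p.2 ≤ f p.1} := by
      ext γ
      simp only [hZ, SRel, mem_ofPred_eq, mem_inter_iff, mem_preimage, mem_iInter]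
      constructor
      · rintro ⟨h1, h2, h3⟩
        exact ⟨h1, fun x' hx' => ⟨h2, by linarith [h3 x' hx']⟩⟩
      · rintro ⟨h1, h2⟩
        exact ⟨h1, (h2 x₀ hx₀).1, fun x' hx' => by linarith [(h2 x' hx').2]⟩
    rw [this]
    refine (isClosed_closedBall.preimage (continuous_geval 1)).inter ?_
    refine isClosed_biInter fun x' _ => hcl.preimage ?_
    have c0 := continuous_geval (X := X) 0
    have c1 := continuous_geval (X := X) 1
    fun_prop
  obtain ⟨D, hD⟩ : ∃ D, ∀ x ∈ P ∪ (closedBall p r ∪ closedBall q r),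
      ∀ y ∈ P ∪ (closedBall p r ∪ closedBall q r), dist x y ≤ D := by
    obtain ⟨D, hD⟩ := Metric.isBounded_iff.1
      (hPb.union ((isBounded_closedBall (x := p) (r := r)).union (isBounded_closedBall (x := q) (r := r))))
    exact ⟨D, fun x hx y hy => hD hx hy⟩
  have hD0 : 0 ≤ D := dist_nonneg.trans (hD x₀ (Or.inl hx₀) x₀ (Or.inl hx₀))
  have hZc : ∀ z, closedBall z r ⊆ closedBall p r ∪ closedBall q r → IsCompact (Z z) := by
    intro z hz
    refine geo_compact x₀ D _ (hZcl z) ?_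
    rintro γ hγ
    exact ⟨hD _ (Or.inl hγ.2.1) _ (Or.inl hx₀), hD _ (Or.inr (hz hγ.1)) _ (Or.inl hx₀)⟩
  have hZ1 := hZc p subset_union_left
  have hZ2 := hZc q subset_union_right
  set E : Set X := eval 0 '' (Z p) ∩ eval 0 '' (Z q) with hEdef
  have hEeq : {x | (∃ y ∈ closedBall p r, SRel P f x y) ∧ ∃ y ∈ closedBall q r, SRel P f x y}
      ⊆ E := by
    rintro x ⟨⟨y, hy, h⟩, y', hy', h'⟩
    obtain ⟨γ, g0, g1⟩ := hX x y
    obtain ⟨γ', g0', g1'⟩ := hX x y'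
    refine ⟨⟨γ, ⟨by rw [g1]; exact hy, by rw [g0, g1]; exact h⟩, g0⟩,
      ⟨γ', ⟨by rw [g1']; exact hy', by rw [g0', g1']; exact h'⟩, g0'⟩⟩
  have hE0 : m E ≠ 0 := fun h => hne (measure_mono_null hEeq h)
  have hEm : MeasurableSet E := ((hZ1.image (continuous_geval 0)).inter
    (hZ2.image (continuous_geval 0))).measurableSet
  obtain ⟨x₁, hx₁⟩ := nonempty_of_measure_ne_zero hE0
  obtain ⟨T₁, mT₁, hT₁⟩ := section_of_compact hZ1 (hx₁.1.imp fun _ h => h.1)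
  obtain ⟨T₂, mT₂, hT₂⟩ := section_of_compact hZ2 (hx₁.2.imp fun _ h => h.1)
  have hEP : E ⊆ P := by
    rintro x ⟨⟨γ, hγ, rfl⟩, _⟩
    exact hγ.2.1
  have hEt : ∀ s ⊆ E, m s ≠ ⊤ := fun s hs => hm_bdd s (hPb.subset (hs.trans hEP))
  have hdual : ∀ Q : Set X, MeasurableSet Q → Q ⊆ closedBall p r ∪ closedBall q r →
      DualPair P Q f (cinf P f) (M + D ^ 2) := by
    intro Q mQ hQ
    refine ⟨hP.measurableSet, mQ, ?_, mf, cinf_meas hf, ?_, ?_, ?_⟩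
    · exact hPb.union ((isBounded_closedBall.union isBounded_closedBall).subset hQ)
    · intro x hx; nlinarith [hf x hx]
    · intro y hy
      exact cinf_abs ⟨x₀, hx₀⟩ hf fun x hx => hD x (Or.inl hx) y (Or.inr (hQ hy))
    · intro x hx y hy
      linarith [cinf_le hf hx y]
  set δ := dist p q - 2 * r with hδ
  have hδ0 : 0 < δ := by linarith
  set η := min (1 / 2) (δ / (8 * (D + 1))) with hη
  have hη0 : 0 < η := lt_min (by norm_num) (by positivity)
  have hη1 : η ≤ 1 / 2 := min_le_left _ _
  have hη2 : η * (8 * (D + 1)) ≤ δ := by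
    rw [← le_div_iff₀ (by positivity)]; exact min_le_right _ _
  set c : unitInterval := ⟨1 - η, by linarith, by linarith⟩ with hc
  have hcv : (c : ℝ) = 1 - η := rfl
  have hc0 : 0 < (c : ℝ) := by rw [hcv]; linarith
  have hc1 : (c : ℝ) < 1 := by rw [hcv]; linarith
  obtain ⟨π₁, i₁, a1, b1, G1⟩ := lemmaH hN hCD (hdual (closedBall p r) measurableSet_closedBall
    subset_union_left) hEm hE0 (hEt E subset_rfl) mT₁ (fun x hx => by
      obtain ⟨h1, h2⟩ := hT₁ x hx.1
      exact ⟨⟨h1.2.1, h1.1, h1.2.cinf hf⟩, h2⟩) hc1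
  haveI := prob_map π₁ 0
  obtain ⟨E', hE'E, mE', hE'0, hE'ac⟩ := density_set hEm a1
  obtain ⟨π₂, i₂, a2, b2, G2⟩ := lemmaH hN hCD (hdual (closedBall q r) measurableSet_closedBall
    subset_union_right) mE' hE'0 (hEt E' hE'E) mT₂ (fun x hx => by
      obtain ⟨h1, h2⟩ := hT₂ x (hE'E hx).2
      exact ⟨⟨h1.2.1, h1.1, h1.2.cinf hf⟩, h2⟩) hc1
  haveI := prob_map π₂ 0
  obtain ⟨E'', hE''E', mE'', hE''0, hE''ac⟩ := density_set mE' a2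
  haveI : IsFiniteMeasureOnCompacts m := ⟨fun k hk => (hm_bdd k hk.isBounded).lt_top⟩
  obtain ⟨F, hFE, hFc, hF0⟩ := mE''.exists_lt_isCompact_of_ne_top (μ := m)
    (hEt E'' (hE''E'.trans hE'E)) (pos_iff_ne_zero.2 hE''0)
  have hcondF : ∀ s, F ⊆ s → ProbabilityTheory.cond m F ≪ m.restrict s := by
    intro s hs
    refine Measure.AbsolutelyContinuous.trans Measure.smul_absolutelyContinuous ?_
    exact (Measure.restrict_mono hs le_rfl).absolutelyContinuous
  haveI iF : IsProbabilityMeasure (ProbabilityTheory.cond m F) :=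
    ProbabilityTheory.cond_isProbabilityMeasure_of_finite hF0.ne' (hm_bdd F hFc.isBounded)
  obtain ⟨a, ia, ha, ea⟩ := reweight π₁ (measurable_geval 0) _
    ((hcondF E' (hFE.trans hE''E')).trans hE'ac)
  obtain ⟨b, ib, hb, eb⟩ := reweight π₂ (measurable_geval 0) _ ((hcondF E'' hFE).trans hE''ac)
  have Ga := ha.ae_le G1
  have Gb := hb.ae_le G2
  have hgood : Good ((2⁻¹ : ℝ≥0∞) • (a + b)) := by
    refine ⟨_, _, _, _, _, hdual (closedBall p r ∪ closedBall q r)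
      (measurableSet_closedBall.union measurableSet_closedBall) subset_rfl, ?_⟩
    refine (Measure.smul_absolutelyContinuous (μ := a + b)).ae_le ?_
    refine (ae_add_measure_iff (p := fun γ =>
      γ ∈ GSet P (closedBall p r ∪ closedBall q r) f (cinf P f))).2 ⟨?_, ?_⟩
    · exact Filter.mem_of_superset Ga fun γ hγ => ⟨hγ.1, Or.inl hγ.2.1, hγ.2.2⟩
    · exact Filter.mem_of_superset Gb fun γ hγ => ⟨hγ.1, Or.inr hγ.2.1, hγ.2.2⟩
  have hgood' := hgood.restr_left c
  rw [Measure.map_smul, Measure.map_add _ _ (measurable_restrGeo 0 c)] at hgood'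
  have hgood2 := hgood'.mono (Measure.absolutelyContinuous_smul (by simp))
  haveI : IsProbabilityMeasure (a.map (restrGeo 0 c)) :=
    Measure.isProbabilityMeasure_map (measurable_restrGeo 0 c).aemeasurable
  haveI : IsProbabilityMeasure (b.map (restrGeo 0 c)) :=
    Measure.isProbabilityMeasure_map (measurable_restrGeo 0 c).aemeasurable
  have hV : ∀ z : X, ∀ ν : Measure (Geo X), closedBall z r ⊆ closedBall p r ∪ closedBall q r →
      (∀ᵐ γ ∂ν, γ ∈ GSet P (closedBall z r) f (cinf P f)) →
      ∀ᵐ γ ∂(ν.map (restrGeo 0 c)), eval c γ ∈ closedBall z (r + 2 * η * D) := by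
    intro z ν hz hν
    refine (ae_map_iff (measurable_restrGeo 0 c).aemeasurable
      ((measurable_geval c) measurableSet_closedBall)).2 ?_
    filter_upwards [hν] with γ hγ
    rw [eval_restrGeo, mem_closedBall]
    have h1 : dist (eval 1 γ) z ≤ r := hγ.2.1
    have h2 : dist (eval 0 γ) (eval 1 γ) ≤ D := hD _ (Or.inl hγ.1) _ (Or.inr (hz hγ.2.1))
    have h3 := dist_triangle (eval (restrPt 0 c c) γ) (eval 1 γ) z
    have h4 : dist (eval (restrPt 0 c c) γ) (eval 1 γ) ≤ 2 * η * D := by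
      rw [geo_dist]
      have e : ((restrPt 0 c c : unitInterval) : ℝ) = (1 - η) * (1 - η) := by
        simp [restrPt, hcv]
      have hab : |((restrPt 0 c c : unitInterval) : ℝ) - ((1 : unitInterval) : ℝ)| ≤ 2 * η := by
        rw [e, Set.Icc.coe_one, abs_le]
        constructor <;> nlinarith
      exact mul_le_mul hab h2 dist_nonneg (by linarith)
    linarith
  refine main_contra hm_bdd hN hCD hGT hgood2 hFc hF0.ne' ?_ ?_ ?_ ?_ hc0 hc1
    (hV p a subset_union_left Ga) (hV q b subset_union_right Gb) measurableSet_closedBall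
    measurableSet_closedBall ?_
  · rw [map_restr, restrPt_zero, ea]
  · rw [map_restr, restrPt_one]; exact (ha.map (measurable_geval c)).trans b1
  · rw [map_restr, restrPt_zero, eb]
  · rw [map_restr, restrPt_one]; exact (hb.map (measurable_geval c)).trans b2
  · refine closedBall_disjoint_closedBall ?_
    nlinarith

lemma claimU [BorelSpace X] [ProperSpace X] (hX : IsGeodesicSpace X) {m : Measure X}
    [SigmaFinite m]
    (hm_bdd : ∀ s : Set X, Bornology.IsBounded s → m s ≠ ⊤) {K N : ℝ} (hN : 1 ≤ N)
    (hCD : IsCDStar K N m) (hGT : GoodTransport m) {P : Set X} (hP : IsCompact P) {f : X → ℝ}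
    (mf : Measurable f) {M : ℝ} (hf : ∀ x ∈ P, |f x| ≤ M)
    (hcl : IsClosed {p : X × ℝ | p.1 ∈ P ∧ p.2 ≤ f p.1}) :
    ∀ᵐ x ∂m, ∀ y y', SRel P f x y → SRel P f x y' → y = y' := by
  rcases isEmpty_or_nonempty X with hem | hne
  · exact Filter.Eventually.of_forall fun x => hem.elim x
  have key : ∀ᵐ x ∂m, ∀ i j k : ℕ, 2 * (1 / ((k : ℝ) + 1)) <
      dist (TopologicalSpace.denseSeq X i) (TopologicalSpace.denseSeq X j) →
      ¬ ((∃ y ∈ closedBall (TopologicalSpace.denseSeq X i) (1 / ((k : ℝ) + 1)), SRel P f x y) ∧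
        ∃ y ∈ closedBall (TopologicalSpace.denseSeq X j) (1 / ((k : ℝ) + 1)), SRel P f x y) := by
    refine ae_all_iff.2 fun i => ae_all_iff.2 fun j => ae_all_iff.2 fun k => ?_
    refine Filter.eventually_imp_distrib_left.2 fun h => ?_
    have := pair_null hX hm_bdd hN hCD hGT hP mf hf hcl _ _ _ h
    rw [ae_iff]
    simpa only [not_not] using this
  filter_upwards [key] with x hx y y' h h'
  by_contra hyy
  have hρ : 0 < dist y y' := dist_pos.2 hyy
  obtain ⟨k, hk⟩ := exists_nat_one_div_lt (show 0 < dist y y' / 4 by positivity)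
  have hk0 : 0 < 1 / ((k : ℝ) + 1) := by positivity
  obtain ⟨i, hi⟩ := (TopologicalSpace.denseRange_denseSeq X).exists_dist_lt y hk0
  obtain ⟨j, hj⟩ := (TopologicalSpace.denseRange_denseSeq X).exists_dist_lt y' hk0
  refine hx i j k ?_ ⟨⟨y, hi.le, h⟩, y', hj.le, h'⟩
  have h1 := dist_triangle4 y (TopologicalSpace.denseSeq X i) (TopologicalSpace.denseSeq X j) y'
  rw [dist_comm (TopologicalSpace.denseSeq X j) y'] at h1
  linarith

lemma real_form {φ : X → EReal} (h : cConcave φ) : (∀ x, φ x ≠ ⊤) ∧ ∃ (Y : Set X) (g : X → ℝ),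
    Y.Nonempty ∧
    ∀ (x : X) (c : ℝ), (c : EReal) ≤ φ x ↔ ∀ y ∈ Y, c ≤ dist x y ^ 2 / 2 - g y := by
  obtain ⟨⟨x₀, hx₀⟩, htop, ψ, hψ, hφ⟩ := h
  have key : ∀ (x : X) (c : ℝ), (c : EReal) ≤ φ x ↔
      ∀ y ∈ {y | ψ y ≠ ⊥}, c ≤ dist x y ^ 2 / 2 - (ψ y).toReal := by
    intro x c
    rw [hφ x, le_iInf_iff]
    refine forall_congr' fun y => ?_
    by_cases hy : ψ y = ⊥
    · simp [hy]
    · have : ψ y = ((ψ y).toReal : EReal) := (EReal.coe_toReal (hψ y) hy).symm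
      rw [this, ← EReal.coe_sub, EReal.coe_le_coe_iff, EReal.toReal_coe]
      exact ⟨fun h _ => h, fun h' => h' hy⟩
  refine ⟨htop, {y | ψ y ≠ ⊥}, fun y => (ψ y).toReal, ?_, key⟩
  by_contra hne
  rw [not_nonempty_iff_eq_empty] at hne
  refine htop x₀ (EReal.eq_top_iff_forall_lt _ |>.2 fun c => ?_)
  have := (key x₀ (c + 1)).2 (by rw [hne]; simp)
  refine lt_of_lt_of_le ?_ this
  exact_mod_cast lt_add_one c

lemma superdiff_iff {φ : X → EReal} (htop : ∀ x, φ x ≠ ⊤) {x₀ y : X} {a : ℝ}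
    (ha : φ x₀ = a) : (x₀, y) ∈ cSuperdiff φ ↔
      ∀ (x : X) (c : ℝ), (c : EReal) ≤ φ x → c - dist x y ^ 2 / 2 ≤ a - dist x₀ y ^ 2 / 2 := by
  unfold cSuperdiff
  show φ x₀ + cTransform φ y = _ ↔ _
  rw [ha]
  have hle : cTransform φ y ≤ ((dist x₀ y ^ 2 / 2 - a : ℝ) : EReal) := by
    refine (iInf_le _ x₀).trans ?_
    rw [ha, ← EReal.coe_sub]
  have hiff : (a : EReal) + cTransform φ y = ((dist x₀ y ^ 2 / 2 : ℝ) : EReal) ↔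
      ((dist x₀ y ^ 2 / 2 - a : ℝ) : EReal) ≤ cTransform φ y := by
    induction hc : cTransform φ y with
    | bot =>
      rw [EReal.add_bot]
      exact ⟨fun h => absurd h.symm (EReal.coe_ne_bot _),
        fun h => absurd (le_bot_iff.1 h) (EReal.coe_ne_bot _)⟩
    | top =>
      rw [hc] at hle
      exact absurd (top_le_iff.1 hle) (EReal.coe_ne_top _)
    | coe b =>
      rw [hc] at hle
      rw [← EReal.coe_add, EReal.coe_eq_coe_iff, EReal.coe_le_coe_iff]
      rw [EReal.coe_le_coe_iff] at hle
      constructor <;> intro h <;> linarith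
  rw [hiff]
  unfold cTransform
  rw [le_iInf_iff]
  refine forall_congr' fun x => ?_
  induction hx : φ x with
  | bot => simp
  | top => exact absurd hx (htop x)
  | coe b =>
    rw [← EReal.coe_sub, EReal.coe_le_coe_iff]
    constructor
    · intro h c hc
      rw [EReal.coe_le_coe_iff] at hc
      linarith
    · intro h
      have := h b le_rfl
      linarith

lemma exists_superdiff [ProperSpace X] (hX : IsGeodesicSpace X) {φ : X → EReal}
    (htop : ∀ x, φ x ≠ ⊤) {Y : Set X} {g : X → ℝ}
    (hY : ∀ (x : X) (c : ℝ), (c : EReal) ≤ φ x ↔ ∀ y ∈ Y, c ≤ dist x y ^ 2 / 2 - g y)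
    {x₀ : X} (hx₀ : x₀ ∈ interior {x | φ x ≠ ⊥}) : ∃ y, (x₀, y) ∈ cSuperdiff φ := by
  have hreal : ∀ x, φ x ≠ ⊥ → φ x = ((φ x).toReal : EReal) := fun x hx =>
    (EReal.coe_toReal (htop x) hx).symm
  have hφ0 : φ x₀ ≠ ⊥ := interior_subset hx₀
  set a := (φ x₀).toReal with ha
  have ha' : φ x₀ = a := hreal x₀ hφ0
  obtain ⟨r, hr0, hr⟩ := Metric.nhds_basis_closedBall.mem_iff.1 (mem_interior_iff_mem_nhds.1 hx₀)
  -- boundedness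
  have hbdd : ∃ n : ℕ, ∀ y ∈ Y, dist x₀ y ^ 2 / 2 - g y < a + 1 → dist x₀ y ≤ n + r := by
    by_contra! hcon
    choose y hyY hylt hyd using hcon
    have hz : ∀ n, ∃ z, dist x₀ z = r ∧ dist z (y n) = dist x₀ (y n) - r := by
      intro n
      have hd0 : 0 < dist x₀ (y n) := lt_of_le_of_lt (by positivity) (hyd n)
      have hdr : r ≤ dist x₀ (y n) := by
        have := hyd n
        have : (0 : ℝ) ≤ n := by positivity
        linarith
      obtain ⟨γ, g0, g1⟩ := hX x₀ (y n)
      have hdr1 : r / dist x₀ (y n) ≤ 1 := (div_le_one hd0).2 hdr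
      let u : unitInterval := ⟨r / dist x₀ (y n), by positivity, hdr1⟩
      refine ⟨eval u γ, ?_, ?_⟩
      · have := geo_dist γ 0 u
        rw [g0, g1] at this
        rw [this]
        simp only [Set.Icc.coe_zero, zero_sub, abs_neg, u]
        rw [abs_of_nonneg (by positivity)]
        field_simp
      · have := geo_dist γ u 1
        rw [g0, g1] at this
        rw [this]
        simp only [Set.Icc.coe_one, u]
        rw [abs_sub_comm, abs_of_nonneg (by linarith)]
        field_simp
    choose z hz1 hz2 using hz
    obtain ⟨w, hw, θ, hθ, hlim⟩ := (isCompact_closedBall x₀ r).tendsto_subseq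
      (x := z) (fun n => by rw [mem_closedBall', hz1])
    have hb := hreal w (hr hw)
    set b := (φ w).toReal
    have hev := Metric.tendsto_nhds.1 hlim (r / 2) (by positivity)
    obtain ⟨n₁, hn₁⟩ := Filter.eventually_atTop.1 hev
    obtain ⟨n₂, hn₂⟩ := exists_nat_gt ((a + 1 + r ^ 2 / 8 - b) / (r / 2))
    rw [div_lt_iff₀ (by positivity)] at hn₂
    set n := max n₁ n₂
    have h1 : dist (z (θ n)) w < r / 2 := hn₁ n (le_max_left _ _)
    have h2 := (hY w b).1 hb.ge (y (θ n)) (hyY _)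
    have h3 : dist w (y (θ n)) ≤ dist x₀ (y (θ n)) - r / 2 := by
      have := dist_triangle w (z (θ n)) (y (θ n))
      rw [hz2, dist_comm w (z (θ n))] at this
      linarith
    have h4 : dist w (y (θ n)) ^ 2 ≤ (dist x₀ (y (θ n)) - r / 2) ^ 2 :=
      pow_le_pow_left₀ dist_nonneg h3 2
    have h5 := hylt (θ n)
    have h6 := hyd (θ n)
    have h7 : (n₂ : ℝ) ≤ θ n := by
      exact_mod_cast (le_max_right n₁ n₂).trans (hθ.id_le n)
    nlinarith
  obtain ⟨n₀, hn₀⟩ := hbdd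
  have hmin : ∀ n : ℕ, ∃ y ∈ Y, dist x₀ y ^ 2 / 2 - g y < a + 1 / ((n : ℝ) + 1) := by
    intro n
    by_contra! hcon
    have := (hY x₀ _).2 hcon
    rw [ha', EReal.coe_le_coe_iff] at this
    have : 0 < 1 / ((n : ℝ) + 1) := by positivity
    linarith
  choose y hyY hylt using hmin
  have hyb : ∀ n, y n ∈ closedBall x₀ (n₀ + r) := by
    intro n
    rw [mem_closedBall']
    refine hn₀ _ (hyY n) ((hylt n).trans_le ?_)
    have : 1 / ((n : ℝ) + 1) ≤ 1 := by
      rw [div_le_one (by positivity)]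
      have : (0 : ℝ) ≤ n := by positivity
      linarith
    linarith
  obtain ⟨w, hw, θ, hθ, hlim⟩ := (isCompact_closedBall x₀ (n₀ + r)).tendsto_subseq hyb
  refine ⟨w, (superdiff_iff htop ha').2 fun x c hc => ?_⟩
  have hl1 : Filter.Tendsto (fun n => c - dist x (y (θ n)) ^ 2 / 2) Filter.atTop
      (nhds (c - dist x w ^ 2 / 2)) :=
    (((tendsto_const_nhds.dist hlim).pow 2).div_const 2).const_sub c
  have hl2 : Filter.Tendsto (fun n => a + 1 / (((θ n : ℕ) : ℝ) + 1) - dist x₀ (y (θ n)) ^ 2 / 2)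
      Filter.atTop (nhds (a + 0 - dist x₀ w ^ 2 / 2)) :=
    ((tendsto_one_div_add_atTop_nhds_zero_nat.comp hθ.tendsto_atTop).const_add a).sub
      (((tendsto_const_nhds.dist hlim).pow 2).div_const 2)
  have := le_of_tendsto_of_tendsto' hl1 hl2 (fun n => by
    have h1 := (hY x c).1 hc (y (θ n)) (hyY _)
    have h2 := hylt (θ n)
    linarith)
  linarith

lemma SRel_of_superdiff {φ : X → EReal} (htop : ∀ x, φ x ≠ ⊤) {P : Set X}
    (hP : ∀ x ∈ P, φ x ≠ ⊥) {γ : Geo X} (h0 : eval 0 γ ∈ P)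
    (h : (eval 0 γ, eval 1 γ) ∈ cSuperdiff φ) (s : unitInterval) :
    SRel P (fun x => 2 * (s : ℝ) * (φ x).toReal) (eval 0 γ) (eval s γ) := by
  refine ⟨h0, fun x' hx' => ?_⟩
  have hreal : ∀ x ∈ P, φ x = ((φ x).toReal : EReal) := fun x hx =>
    (EReal.coe_toReal (htop x) (hP x hx)).symm
  have h1 := (superdiff_iff htop (hreal _ h0)).1 h x' _ (hreal _ hx').ge
  have d0 : dist (eval 0 γ) (eval s γ) = s * dist (eval 0 γ) (eval 1 γ) := by
    rw [geo_dist γ 0 s]; simp [abs_of_nonneg s.2.1]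
  have d1 : dist (eval s γ) (eval 1 γ) = (1 - s) * dist (eval 0 γ) (eval 1 γ) := by
    rw [geo_dist γ s 1, abs_sub_comm]; simp only [Set.Icc.coe_one]
    rw [abs_of_nonneg (by linarith [s.2.2])]
  have h2 := pot_ineq s.2.1 s.2.2 (dist_nonneg (x := x') (y := eval 1 γ))
    (D := dist (eval 0 γ) (eval 1 γ)) (a := dist x' (eval s γ))
    (by rw [← d1]; exact dist_triangle _ _ _)
  rw [d0]
  have h3 := mul_le_mul_of_nonneg_left h1 (show 0 ≤ 2 * (s : ℝ) by linarith [s.2.1])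
  have e : (s * dist (eval 0 γ) (eval 1 γ)) ^ 2 = (s : ℝ) ^ 2 * dist (eval 0 γ) (eval 1 γ) ^ 2 := by
    ring
  show 2 * (s : ℝ) * (φ x').toReal - _ ≤ 2 * (s : ℝ) * (φ (eval 0 γ)).toReal - _
  nlinarith

lemma final [CompleteSpace X] [TopologicalSpace.SeparableSpace X] [ProperSpace X] [BorelSpace X]
    (hX : IsGeodesicSpace X) (m : Measure X)
    (hm_bdd : ∀ s : Set X, Bornology.IsBounded s → m s ≠ ⊤)
    (K N : ℝ) (hN : 1 ≤ N) (hCD : IsCDStar K N m) (hGT : GoodTransport m)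
    (φ : X → EReal) (hφ : cConcave φ) :
    ∀ᵐ x ∂(m.restrict (interior {x | φ x ≠ ⊥})),
      ∃! γ : Geo X, eval 0 γ = x ∧ (x, eval 1 γ) ∈ cSuperdiff φ := by
  haveI : IsFiniteMeasureOnCompacts m := ⟨fun k hk => (hm_bdd k hk.isBounded).lt_top⟩
  haveI : IsLocallyFiniteMeasure m := isLocallyFiniteMeasure_of_isFiniteMeasureOnCompacts
  haveI : SigmaFinite m := inferInstance
  obtain ⟨xs, -⟩ := hφ.1
  obtain ⟨htop, Y, g, ⟨y₀, hy₀⟩, hY⟩ := real_form hφ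
  have hreal : ∀ x, φ x ≠ ⊥ → φ x = ((φ x).toReal : EReal) := fun x hx =>
    (EReal.coe_toReal (htop x) hx).symm
  have hclY : IsClosed {p : X × ℝ | (p.2 : EReal) ≤ φ p.1} := by
    have : {p : X × ℝ | (p.2 : EReal) ≤ φ p.1} =
        ⋂ y ∈ Y, {p : X × ℝ | p.2 ≤ dist p.1 y ^ 2 / 2 - g y} := by
      ext p
      rw [mem_iInter₂]
      exact hY p.1 p.2
    rw [this]
    refine isClosed_biInter fun y _ => isClosed_le (by fun_prop) (by fun_prop)
  have hclc : ∀ c : ℝ, IsClosed {x : X | (c : EReal) ≤ φ x} := fun c =>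
    hclY.preimage (show Continuous fun x : X => (x, c) by fun_prop)
  have mφ : Measurable φ := by
    refine measurable_of_Ici fun c => ?_
    induction c with
    | bot => 
      have : φ ⁻¹' Ici ⊥ = univ := by ext; simp
      rw [this]; exact MeasurableSet.univ
    | top =>
      have : φ ⁻¹' Ici ⊤ = ∅ := by
        ext x
        simp only [mem_preimage, mem_Ici, top_le_iff, mem_empty_iff_false, iff_false]
        exact htop x
      rw [this]; exact MeasurableSet.empty
    | coe c => exact (hclc c).measurableSet
  let P : ℕ → Set X := fun n => closedBall xs n ∩ {x | ((-(n : ℝ) : ℝ) : EReal) ≤ φ x}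
  have hPc : ∀ n, IsCompact (P n) := fun n => (isCompact_closedBall _ _).inter_right (hclc _)
  have hPb : ∀ n, ∀ x ∈ P n, φ x ≠ ⊥ := by
    intro n x hx h
    have h2 : ((-(n : ℝ) : ℝ) : EReal) ≤ φ x := hx.2
    rw [h] at h2
    exact absurd (le_bot_iff.1 h2) (EReal.coe_ne_bot _)
  have claim : ∀ᵐ x ∂m, ∀ (n k : ℕ), 0 < ((TopologicalSpace.denseSeq unitInterval k : unitInterval) : ℝ) →
      ∀ y y', SRel (P n) (fun x => 2 * ((TopologicalSpace.denseSeq unitInterval k : unitInterval) : ℝ) * (φ x).toReal) x y →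
        SRel (P n) (fun x => 2 * ((TopologicalSpace.denseSeq unitInterval k : unitInterval) : ℝ) * (φ x).toReal) x y' → y = y' := by
    refine ae_all_iff.2 fun n => ae_all_iff.2 fun k => Filter.eventually_imp_distrib_left.2 fun hs => ?_
    generalize TopologicalSpace.denseSeq unitInterval k = s at hs
    have hs1 := s.2.2
    refine claimU hX hm_bdd hN hCD hGT (hPc n) (mφ.ereal_toReal.const_mul _)
      (M := 2 * (n + (((n : ℝ) + dist xs y₀) ^ 2 / 2 + |g y₀|))) ?_ ?_
    · intro x hx
      have hr := hreal x (hPb n x hx)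
      have h1 : ((-(n : ℝ) : ℝ) : EReal) ≤ φ x := hx.2
      rw [hr, EReal.coe_le_coe_iff] at h1
      have h2 := (hY x _).1 hr.ge y₀ hy₀
      have h3 : dist x y₀ ≤ n + dist xs y₀ := (dist_triangle x xs y₀).trans (by
        have : dist x xs ≤ n := hx.1
        linarith)
      have h4 := pow_le_pow_left₀ dist_nonneg h3 2
      have h5 := neg_abs_le (g y₀)
      have hn : (0 : ℝ) ≤ n := by positivity
      have h6 : |(φ x).toReal| ≤ n + (((n : ℝ) + dist xs y₀) ^ 2 / 2 + |g y₀|) := by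
        have : 0 ≤ ((n : ℝ) + dist xs y₀) ^ 2 / 2 := by positivity
        rw [abs_le]
        constructor <;> linarith [abs_nonneg (g y₀)]
      rw [abs_mul, abs_of_nonneg (by positivity)]
      exact mul_le_mul (by linarith) h6 (abs_nonneg _) (by norm_num)
    · have : {p : X × ℝ | p.1 ∈ P n ∧ p.2 ≤ 2 * (s : ℝ) * (φ p.1).toReal} =
          (Prod.fst ⁻¹' P n) ∩ ((fun p : X × ℝ => (p.1, p.2 / (2 * (s : ℝ)))) ⁻¹'
            {p : X × ℝ | (p.2 : EReal) ≤ φ p.1}) := by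
        ext p
        refine and_congr_right fun hp => ?_
        show _ ↔ ((p.2 / (2 * (s : ℝ)) : ℝ) : EReal) ≤ φ p.1
        have hr := hreal p.1 (hPb n _ hp)
        conv_rhs => rw [hr]
        rw [EReal.coe_le_coe_iff, div_le_iff₀ (by positivity), mul_comm]
      rw [this]
      exact ((hPc n).isClosed.preimage continuous_fst).inter
        (hclY.preimage (by fun_prop))
  refine (ae_restrict_iff' isOpen_interior.measurableSet).2 ?_
  filter_upwards [claim] with x hx hxi
  obtain ⟨y, hy⟩ := exists_superdiff hX htop hY hxi
  obtain ⟨γ, g0, g1⟩ := hX x y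
  refine ⟨γ, ⟨g0, by rw [g1]; exact hy⟩, ?_⟩
  rintro γ' ⟨g0', hγ'⟩
  have hr := hreal x (interior_subset hxi)
  obtain ⟨n, hn⟩ := exists_nat_ge (max (dist x xs) (-(φ x).toReal))
  have hxP : x ∈ P n := by
    refine ⟨(le_max_left _ _).trans hn, ?_⟩
    show ((-(n : ℝ) : ℝ) : EReal) ≤ φ x
    rw [hr, EReal.coe_le_coe_iff]
    linarith [(le_max_right _ _).trans hn]
  have hcc : (γ'.1 : unitInterval → X) = γ.1 := by
    refine (TopologicalSpace.denseRange_denseSeq unitInterval).equalizer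
      γ'.1.continuous γ.1.continuous (funext fun k => ?_)
    show eval (TopologicalSpace.denseSeq unitInterval k) γ' = eval (TopologicalSpace.denseSeq unitInterval k) γ
    rcases (TopologicalSpace.denseSeq unitInterval k).2.1.eq_or_lt with h0 | h0
    · have : TopologicalSpace.denseSeq unitInterval k = 0 := Subtype.ext h0.symm
      rw [this, g0, g0']
    · refine hx n k h0 _ _ ?_ ?_
      · have := SRel_of_superdiff htop (hPb n) (γ := γ') (by rw [g0']; exact hxP)
          (by rw [g0']; exact hγ') (TopologicalSpace.denseSeq unitInterval k)
        rwa [g0'] at this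
      · have := SRel_of_superdiff htop (hPb n) (γ := γ) (by rw [g0]; exact hxP)
          (by rw [g0, g1]; exact hy) (TopologicalSpace.denseSeq unitInterval k)
        rwa [g0] at this
  exact geo_ext fun t => congrFun hcc t

/-- **Exponentiation** (Theorem 1.3): on a `CD*(K,N)` space with the good transport property,
for any `c`-concave function `φ` and `m`-a.e. `x` in the interior of `{φ > -∞}` there is exactly
one geodesic `γ` with `γ₀ = x` and `γ₁ ∈ ∂ᶜφ(x)`. -/
theorem exponentiation
    [CompleteSpace X] [TopologicalSpace.SeparableSpace X] [ProperSpace X] [BorelSpace X]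
    (hX : IsGeodesicSpace X) (m : Measure X)
    (hm_bdd : ∀ s : Set X, Bornology.IsBounded s → m s ≠ ⊤)
    (hm_supp : ∀ x : X, ∀ r : ℝ, 0 < r → 0 < m (ball x r))
    (K N : ℝ) (hN : 1 ≤ N) (hCD : IsCDStar K N m) (hGT : GoodTransport m)
    (φ : X → EReal) (hφ : cConcave φ) :
    ∀ᵐ x ∂(m.restrict (interior {x | φ x ≠ ⊥})),
      ∃! γ : Geo X, eval 0 γ = x ∧ (x, eval 1 γ) ∈ cSuperdiff φ := by
  exact final hX m hm_bdd K N hN hCD hGT φ hφ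

end
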